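/- arXiv:1206.0835 — 5 statements merged into one kernel-verified Lean document; each statement's English description precedes it below -/
import Mathlib

section
/- For every finitely supported radial function $f$ on $\mathbb{T}$ (identified with a function $f:\mathbb{N}\to\mathbb{C}$ of the distance to the base point) and every $\lambda\in\mathbb{C}\setminus(\tau/2)\mathbb{Z}$, the spherical Fourier transform factors through the Abel transform: $\mathcal{H}f(\lambda)=\mathcal{F}(\mathcal{A}f)(\lambda)$, where $\mathcal{F}g(\lambda)=\sum_{n\in\mathbb{Z}}g(n)\,Q^{in\lambda}$. -/
noncomputable section

open Complex MeasureTheory Filter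
open scoped ENNReal NNReal Topology

/-- `τ = 2π / log Q`. -/
def tauQ (Q : ℕ) : ℝ := 2 * Real.pi / Real.log Q

/-- The meromorphic function `𝐜(z)`. -/
def cFun (Q : ℕ) (z : ℂ) : ℂ :=
  (1 / ((Real.sqrt Q : ℂ) + (Real.sqrt Q : ℂ)⁻¹)) *
    (((Q : ℂ) ^ ((1 / 2 : ℂ) + Complex.I * z) -
        (Q : ℂ) ^ (-(1 / 2 : ℂ) - Complex.I * z)) /
      ((Q : ℂ) ^ (Complex.I * z) - (Q : ℂ) ^ (-(Complex.I * z))))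

/-- The spherical function `φ_λ(n) = 𝐜(λ) Q^{(-1/2+iλ)n} + 𝐜(-λ) Q^{(-1/2-iλ)n}`
(for `λ ∉ (τ/2)ℤ`). -/
def sphFn (Q : ℕ) (lam : ℂ) (n : ℕ) : ℂ :=
  cFun Q lam * (Q : ℂ) ^ ((-(1 / 2 : ℂ) + Complex.I * lam) * (n : ℂ)) +
    cFun Q (-lam) * (Q : ℂ) ^ ((-(1 / 2 : ℂ) - Complex.I * lam) * (n : ℂ))

/-- The spherical Fourier transform of a radial function `f` on the tree,
`ℋf(λ) = f(0) + ∑_{n≥1} (Q+1) Q^{n-1} f(n) φ_λ(n)`. -/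
def sphTransform (Q : ℕ) (f : ℕ → ℂ) (lam : ℂ) : ℂ :=
  f 0 + ∑' n : ℕ, ((Q : ℂ) + 1) * (Q : ℂ) ^ n * f (n + 1) * sphFn Q lam (n + 1)

/-- The Abel transform
`𝒜f(n) = Q^{|n|/2} f(|n|) + (Q^{1/2}-Q^{-1/2}) Q^{-1/2} ∑_{k≥1} Q^{|n|/2+k} f(|n|+2k)`,
an even function on `ℤ`. -/
def abelT (Q : ℕ) (f : ℕ → ℂ) (n : ℤ) : ℂ :=
  (((Q : ℝ) ^ ((n.natAbs : ℝ) / 2) : ℝ) : ℂ) * f n.natAbs +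
    (((Real.sqrt Q - (Real.sqrt Q)⁻¹) / Real.sqrt Q : ℝ) : ℂ) *
      ∑' k : ℕ, (((Q : ℝ) ^ ((n.natAbs : ℝ) / 2 + ((k : ℝ) + 1)) : ℝ) : ℂ) *
        f (n.natAbs + 2 * (k + 1))

/-- The Fourier transform on `ℤ`, `ℱg(λ) = ∑_{n ∈ ℤ} g(n) Q^{inλ}`. -/
def fourierZ (Q : ℕ) (g : ℤ → ℂ) (lam : ℂ) : ℂ :=
  ∑' n : ℤ, g n * (Q : ℂ) ^ (Complex.I * (n : ℂ) * lam)

theorem natCast_cpow_half (Q : ℕ) : (Q : ℂ) ^ (1 / 2 : ℂ) = (Real.sqrt Q : ℂ) := by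
  rw [Real.sqrt_eq_rpow, Complex.ofReal_cpow (Nat.cast_nonneg Q)]
  norm_num

theorem rpow_natCast_div_two (Q m : ℕ) :
    (Q : ℝ) ^ ((m : ℝ) / 2) = Real.sqrt Q ^ m := by
  rw [Real.sqrt_eq_rpow, ← Real.rpow_natCast, ← Real.rpow_mul (Nat.cast_nonneg Q)]
  congr 1
  ring

theorem summable_abelT_tail (Q : ℕ) (f : ℕ →₀ ℂ) (n : ℕ) :
    Summable fun k : ℕ => (((Q : ℝ) ^ ((n : ℝ) / 2 + ((k : ℝ) + 1)) : ℝ) : ℂ) *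
      f (n + 2 * (k + 1)) := by
  refine summable_of_hasFiniteSupport ?_
  refine (f.hasFiniteSupport.preimage (f := fun k : ℕ => n + 2 * (k + 1))
    (fun a _ b _ h => by simpa using h)).subset ?_
  intro k hk
  exact right_ne_zero_of_mul hk

theorem abelT_add (Q : ℕ) (f g : ℕ →₀ ℂ) (n : ℤ) :
    abelT Q (f + g : ℕ →₀ ℂ) n = abelT Q f n + abelT Q g n := by
  have h := (summable_abelT_tail Q f n.natAbs).tsum_add (summable_abelT_tail Q g n.natAbs)
  simp only [← mul_add (Complex.ofReal _)] at h
  simp only [abelT, Finsupp.add_apply]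
  rw [h]
  ring

theorem finite_support_abelT (Q : ℕ) (f : ℕ →₀ ℂ) : (Function.support (abelT Q f)).Finite := by
  obtain ⟨N, hN⟩ := f.support.bddAbove
  have hf : ∀ m, N < m → f m = 0 := fun m hm => by
    by_contra h
    exact absurd (hN (Finsupp.mem_support_iff.2 h)) (by omega)
  refine (Set.finite_Icc (-N : ℤ) N).subset fun n hn => ?_
  by_contra h
  have hn' : N < n.natAbs := by
    rw [Set.mem_Icc] at h
    omega
  refine hn ?_
  simp only [abelT, hf _ hn', mul_zero, zero_add]
  have h0 : ∀ k : ℕ, f (n.natAbs + 2 * (k + 1)) = 0 := fun k => hf _ (by omega)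
  simp [h0]

theorem fourierZ_abelT_add (Q : ℕ) (f g : ℕ →₀ ℂ) (lam : ℂ) :
    fourierZ Q (abelT Q (f + g : ℕ →₀ ℂ)) lam =
      fourierZ Q (abelT Q f) lam + fourierZ Q (abelT Q g) lam := by
  have hs : ∀ f : ℕ →₀ ℂ, Summable fun n : ℤ =>
      abelT Q f n * (Q : ℂ) ^ (Complex.I * (n : ℂ) * lam) := fun f =>
    summable_of_hasFiniteSupport
      ((finite_support_abelT Q f).subset fun n hn => left_ne_zero_of_mul hn)
  simp only [fourierZ, abelT_add, add_mul]
  exact (hs f).tsum_add (hs g)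

theorem sphTransform_add (Q : ℕ) (f g : ℕ →₀ ℂ) (lam : ℂ) :
    sphTransform Q (f + g : ℕ →₀ ℂ) lam = sphTransform Q f lam + sphTransform Q g lam := by
  have hs : ∀ f : ℕ →₀ ℂ, Summable fun n : ℕ =>
      ((Q : ℂ) + 1) * (Q : ℂ) ^ n * f (n + 1) * sphFn Q lam (n + 1) := fun f =>
    summable_of_hasFiniteSupport
      ((f.hasFiniteSupport.preimage (f := fun n : ℕ => n + 1)
        (fun a _ b _ h => by simpa using h)).subset fun n hn =>
          right_ne_zero_of_mul (left_ne_zero_of_mul hn))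
  have h := (hs f).tsum_add (hs g)
  simp only [← add_mul, ← mul_add] at h
  simp only [sphTransform, Finsupp.add_apply]
  rw [h]
  ring

theorem abelT_single_natAbs (Q : ℕ) (a : ℂ) {m : ℕ} {n : ℤ} (h : n.natAbs = m) :
    abelT Q (Finsupp.single m a) n = (Real.sqrt Q : ℂ) ^ m * a := by
  subst h
  have h0 : ∀ k : ℕ, Finsupp.single n.natAbs a (n.natAbs + 2 * (k + 1)) = 0 := fun k =>
    Finsupp.single_eq_of_ne (by omega)
  simp only [abelT, rpow_natCast_div_two, h0, Finsupp.single_eq_same]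
  simp

theorem abelT_single_natAbs_add {Q : ℕ} (hQ : 0 < Q) (a : ℂ) {m : ℕ} {n : ℤ} (k : ℕ)
    (h : m = n.natAbs + 2 * (k + 1)) :
    abelT Q (Finsupp.single m a) n =
      (1 - (Q : ℂ)⁻¹) * ((Real.sqrt Q : ℂ) ^ m * a) := by
  have hs : (Real.sqrt Q : ℂ) ≠ 0 := by
    simpa using (Nat.pos_iff_ne_zero.1 hQ)
  have hsq : (Real.sqrt Q : ℂ) ^ 2 = Q := by
    rw [← Complex.ofReal_pow, Real.sq_sqrt (Nat.cast_nonneg Q)]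
    simp
  have hne : n.natAbs ≠ m := by omega
  rw [abelT, Finsupp.single_eq_of_ne hne, tsum_eq_single k]
  · have he : ((n.natAbs : ℝ) / 2 + ((k : ℝ) + 1)) = (m : ℝ) / 2 := by
      rw [h]
      push_cast
      ring
    rw [← h, Finsupp.single_eq_same, he, rpow_natCast_div_two Q m]
    push_cast
    rw [← hsq]
    field_simp
    ring
  · intro j hj
    rw [Finsupp.single_eq_of_ne (by omega), mul_zero]

theorem abelT_single_eq_zero (Q : ℕ) (a : ℂ) {m : ℕ} {n : ℤ} (h : n.natAbs ≠ m)
    (h' : ∀ k : ℕ, n.natAbs + 2 * (k + 1) ≠ m) :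
    abelT Q (Finsupp.single m a) n = 0 := by
  simp [abelT, Finsupp.single_eq_of_ne h, Finsupp.single_eq_of_ne (h' _)]

theorem natCast_cpow_I_mul_int {Q : ℕ} (n : ℤ) (lam : ℂ) :
    (Q : ℂ) ^ (Complex.I * (n : ℂ) * lam) = ((Q : ℂ) ^ (Complex.I * lam)) ^ n := by
  rw [← Complex.cpow_mul_int]
  congr 1
  ring

theorem natCast_cpow_I_mul_sub_inv_ne_zero {Q : ℕ} (hQ : 2 ≤ Q) {lam : ℂ}
    (hlam : ∀ k : ℤ, lam ≠ ((tauQ Q / 2 : ℝ) : ℂ) * (k : ℂ)) :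
    (Q : ℂ) ^ (Complex.I * lam) - ((Q : ℂ) ^ (Complex.I * lam))⁻¹ ≠ 0 := by
  intro h
  have hQ0 : (Q : ℂ) ≠ 0 := by
    norm_cast
    omega
  have hw : (Q : ℂ) ^ (Complex.I * lam) ≠ 0 := by simp [Complex.cpow_eq_zero_iff, hQ0]
  have hlog : (Real.log Q : ℂ) ≠ 0 := by
    exact_mod_cast (Real.log_pos (by exact_mod_cast hQ)).ne'
  have h1 : (Q : ℂ) ^ (Complex.I * lam) * (Q : ℂ) ^ (Complex.I * lam) = 1 := by
    nth_rewrite 1 [sub_eq_zero.1 h]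
    exact inv_mul_cancel₀ hw
  rw [Complex.cpow_def_of_ne_zero hQ0, ← Complex.exp_add, Complex.exp_eq_one_iff] at h1
  obtain ⟨k, hk⟩ := h1
  refine hlam k ?_
  rw [← Complex.natCast_log] at hk
  have h2 : (Real.log Q : ℂ) * lam = k * Real.pi := by
    apply mul_left_cancel₀ (mul_ne_zero two_ne_zero Complex.I_ne_zero)
    linear_combination hk
  have h3 : lam = k * Real.pi / Real.log Q := by
    rw [eq_div_iff hlog]
    linear_combination h2
  rw [h3, tauQ, Complex.ofReal_div, Complex.ofReal_div, Complex.ofReal_mul, Complex.ofReal_ofNat]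
  ring

theorem sum_zpow_sub_two_mul {w : ℂ} (hw : w ≠ 0) (m : ℕ) :
    (∑ j ∈ Finset.range m, w ^ ((m : ℤ) - 1 - 2 * j)) * (w - w⁻¹) = w ^ m - (w ^ m)⁻¹ := by
  have h : ∀ j : ℕ, w ^ ((m : ℤ) - 1 - 2 * j) * (w - w⁻¹) =
      w ^ ((m : ℤ) - 2 * j) - w ^ ((m : ℤ) - 2 * (j + 1 : ℕ)) := fun j => by
    rw [mul_sub, ← zpow_add_one₀ hw, ← zpow_sub_one₀ hw]
    congr 2 <;> push_cast <;> ring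
  rw [Finset.sum_mul, Finset.sum_congr rfl fun j _ => h j,
    Finset.sum_range_sub' fun j : ℕ => w ^ ((m : ℤ) - 2 * j)]
  have h0 : (m : ℤ) - 2 * (0 : ℕ) = m := by simp
  have hm : (m : ℤ) - 2 * m = -m := by ring
  rw [h0, hm, zpow_neg, zpow_natCast]

theorem fourierZ_abelT_single_succ {Q : ℕ} (hQ : 0 < Q) (m : ℕ) (a lam : ℂ) :
    fourierZ Q (abelT Q (Finsupp.single (m + 1) a)) lam =
      (Real.sqrt Q : ℂ) ^ (m + 1) * a *
        (((Q : ℂ) ^ (Complex.I * lam)) ^ (m + 1) + (((Q : ℂ) ^ (Complex.I * lam)) ^ (m + 1))⁻¹ +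
          (1 - (Q : ℂ)⁻¹) *
            ∑ j ∈ Finset.range m, ((Q : ℂ) ^ (Complex.I * lam)) ^ ((m : ℤ) - 1 - 2 * j)) := by
  simp only [fourierZ, natCast_cpow_I_mul_int]
  set w := (Q : ℂ) ^ (Complex.I * lam)
  rw [tsum_eq_sum (s := (Finset.range (m + 2)).image fun j : ℕ => (m : ℤ) + 1 - 2 * j),
    Finset.sum_image fun i _ j _ h => by simpa using h, Finset.sum_range_succ,
    Finset.sum_range_succ', abelT_single_natAbs Q a (by omega),
    abelT_single_natAbs Q a (by omega)]
  · have h : ∀ j ∈ Finset.range m,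
        abelT Q (Finsupp.single (m + 1) a) ((m : ℤ) + 1 - 2 * (j + 1 : ℕ)) *
          w ^ ((m : ℤ) + 1 - 2 * (j + 1 : ℕ)) =
        (1 - (Q : ℂ)⁻¹) * ((Real.sqrt Q : ℂ) ^ (m + 1) * a) * w ^ ((m : ℤ) - 1 - 2 * j) := by
      intro j hj
      rw [Finset.mem_range] at hj
      rw [abelT_single_natAbs_add hQ a (min j (m - 1 - j)) (by omega)]
      congr 2
      push_cast
      ring
    have h1 : (m : ℤ) + 1 - 2 * (0 : ℕ) = (m + 1 : ℕ) := by push_cast; ring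
    have h2 : (m : ℤ) + 1 - 2 * (m + 1 : ℕ) = -(m + 1 : ℕ) := by push_cast; ring
    rw [Finset.sum_congr rfl h, ← Finset.mul_sum, h1, h2, zpow_neg, zpow_natCast]
    ring
  · intro n hn
    have hn' : ∀ j : ℕ, j < m + 2 → (m : ℤ) + 1 - 2 * j ≠ n := fun j hj h =>
      hn (Finset.mem_image.2 ⟨j, Finset.mem_range.2 hj, h⟩)
    rw [abelT_single_eq_zero, zero_mul]
    · intro h
      have := hn' 0 (by omega)
      have := hn' (m + 1) (by omega)
      omega
    · intro k h
      have := hn' (k + 1) (by omega)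
      have := hn' (m - k) (by omega)
      omega

theorem fourierZ_abelT_single_zero (Q : ℕ) (a lam : ℂ) :
    fourierZ Q (abelT Q (Finsupp.single 0 a)) lam = a := by
  rw [fourierZ, tsum_eq_single 0]
  · rw [abelT_single_natAbs Q a (m := 0) (n := 0) rfl]
    simp
  · intro n hn
    rw [abelT_single_eq_zero Q a (by omega) (by omega), zero_mul]

theorem cFun_eq {Q : ℕ} (hQ : 0 < Q) (z : ℂ) :
    cFun Q z = 1 / ((Real.sqrt Q : ℂ) + (Real.sqrt Q : ℂ)⁻¹) *
      (((Real.sqrt Q : ℂ) * (Q : ℂ) ^ (Complex.I * z) -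
        (Real.sqrt Q : ℂ)⁻¹ * ((Q : ℂ) ^ (Complex.I * z))⁻¹) /
      ((Q : ℂ) ^ (Complex.I * z) - ((Q : ℂ) ^ (Complex.I * z))⁻¹)) := by
  have hQ0 : (Q : ℂ) ≠ 0 := by exact_mod_cast hQ.ne'
  rw [cFun, ← natCast_cpow_half, Complex.cpow_add _ _ hQ0, sub_eq_add_neg (-(1 / 2 : ℂ)),
    Complex.cpow_add _ _ hQ0, Complex.cpow_neg, Complex.cpow_neg]

theorem sphFn_eq {Q : ℕ} (hQ : 0 < Q) (lam : ℂ) (n : ℕ) :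
    sphFn Q lam n = ((Real.sqrt Q : ℂ) ^ n)⁻¹ *
      (cFun Q lam * ((Q : ℂ) ^ (Complex.I * lam)) ^ n +
        cFun Q (-lam) * (((Q : ℂ) ^ (Complex.I * lam)) ^ n)⁻¹) := by
  have hQ0 : (Q : ℂ) ≠ 0 := by exact_mod_cast hQ.ne'
  rw [sphFn, Complex.cpow_mul_nat, Complex.cpow_mul_nat, sub_eq_add_neg,
    Complex.cpow_add _ _ hQ0, Complex.cpow_add _ _ hQ0, Complex.cpow_neg, Complex.cpow_neg,
    natCast_cpow_half, mul_pow, mul_pow, inv_pow, inv_pow]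
  ring

theorem sphFn_succ {Q : ℕ} (hQ : 2 ≤ Q) {lam : ℂ}
    (hlam : ∀ k : ℤ, lam ≠ ((tauQ Q / 2 : ℝ) : ℂ) * (k : ℂ)) (m : ℕ) :
    ((Q : ℂ) + 1) * (Q : ℂ) ^ m * sphFn Q lam (m + 1) = (Real.sqrt Q : ℂ) ^ (m + 1) *
      (((Q : ℂ) ^ (Complex.I * lam)) ^ (m + 1) + (((Q : ℂ) ^ (Complex.I * lam)) ^ (m + 1))⁻¹ +
        (1 - (Q : ℂ)⁻¹) *
          ∑ j ∈ Finset.range m, ((Q : ℂ) ^ (Complex.I * lam)) ^ ((m : ℤ) - 1 - 2 * j)) := by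
  have hQpos : 0 < Q := by omega
  have hQ0 : (Q : ℂ) ≠ 0 := by exact_mod_cast hQpos.ne'
  have hD := natCast_cpow_I_mul_sub_inv_ne_zero hQ hlam
  have hw : (Q : ℂ) ^ (Complex.I * lam) ≠ 0 := by simp [Complex.cpow_eq_zero_iff, hQ0]
  have hS := sum_zpow_sub_two_mul hw m
  have hs : (Real.sqrt Q : ℂ) ≠ 0 := by
    simpa using (Nat.pos_iff_ne_zero.1 hQpos)
  have hsq : (Q : ℂ) = (Real.sqrt Q : ℂ) ^ 2 := by
    rw [← Complex.ofReal_pow, Real.sq_sqrt (Nat.cast_nonneg Q)]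
    simp
  have hs1 : (Real.sqrt Q : ℂ) ^ 2 + 1 ≠ 0 := by
    rw [← hsq]
    exact_mod_cast Nat.succ_ne_zero Q
  rw [sphFn_eq hQpos, cFun_eq hQpos, cFun_eq hQpos, mul_neg, Complex.cpow_neg, inv_inv,
    eq_div_of_mul_eq hD hS]
  generalize (Q : ℂ) ^ (Complex.I * lam) = w at hw hD
  rw [hsq]
  generalize (Real.sqrt Q : ℂ) = s at hs hs1
  have hD' : w ^ 2 - 1 ≠ 0 := fun h => hD (by field_simp; simpa using h)
  have hneg : w⁻¹ - w = -(w - w⁻¹) := by ring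
  have hDw : w - w⁻¹ = (w ^ 2 - 1) / w := by field_simp
  have hss : s + s⁻¹ = (s ^ 2 + 1) / s := by field_simp
  rw [hneg, hDw, hss, pow_right_comm s 2 m, pow_succ w m, pow_succ s m]
  have hwm : w ^ m ≠ 0 := pow_ne_zero _ hw
  have hsm : s ^ m ≠ 0 := pow_ne_zero _ hs
  generalize w ^ m = W at hwm
  generalize s ^ m = S at hsm
  field_simp
  ring

/-- For finitely supported radial `f` and `λ ∉ (τ/2)ℤ`, the spherical Fourier
transform factors through the Abel transform: `ℋf(λ) = ℱ(𝒜f)(λ)`. -/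
theorem sphTransform_eq_fourier_abel (Q : ℕ) (hQ : 2 ≤ Q) (f : ℕ → ℂ)
    (hf : (Function.support f).Finite) (lam : ℂ)
    (hlam : ∀ k : ℤ, lam ≠ ((tauQ Q / 2 : ℝ) : ℂ) * (k : ℂ)) :
    sphTransform Q f lam = fourierZ Q (abelT Q f) lam := by
  obtain ⟨f, rfl⟩ : ∃ g : ℕ →₀ ℂ, ⇑g = f := ⟨Finsupp.ofSupportFinite f hf, rfl⟩
  clear hf
  induction f using Finsupp.induction_linear with
  | zero => simp [sphTransform, fourierZ, abelT]
  | add f g hf hg => rw [sphTransform_add, fourierZ_abelT_add, hf, hg]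
  | single m a =>
    cases m with
    | zero => simp [fourierZ_abelT_single_zero, sphTransform]
    | succ m =>
      rw [fourierZ_abelT_single_succ (by omega), sphTransform, tsum_eq_single m,
        Finsupp.single_eq_same, Finsupp.single_eq_of_ne (by omega)]
      · linear_combination a * sphFn_succ hQ hlam m
      · intro n hn
        rw [Finsupp.single_eq_of_ne (by omega)]
        ring
end
end

section
/- The Abel transform is inverted by the formula $f(n)=\sum_{k=0}^{\infty}Q^{-\frac{n}{2}-k}\bigl(\mathcal{A}f(n+2k)-\mathcal{A}f(n+2k+2)\bigr)$ for every $n\in\mathbb{N}$, valid for every finitely supported function $f:\mathbb{N}\to\mathbb{C}$. -/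
noncomputable section

open Complex MeasureTheory Filter
open scoped ENNReal NNReal Topology

theorem summable_of_finite_support_comp {g f : ℕ → ℂ} {e : ℕ → ℕ}
    (hf : (Function.support f).Finite) (he : Function.Injective e) :
    Summable fun k => g k * f (e k) := by
  refine summable_of_hasFiniteSupport ((hf.preimage he.injOn).subset fun k hk => ?_)
  exact right_ne_zero_of_mul hk

theorem tsum_sub_succ_of_summable {g : ℕ → ℂ} (hg : Summable g) :
    ∑' k, (g k - g (k + 1)) = g 0 := by
  rw [hg.tsum_sub ((summable_nat_add_iff 1).2 hg), hg.tsum_eq_zero_add, add_sub_cancel_right]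

theorem abelT_sub_abelT_add_two {Q : ℕ} (hQ : Q ≠ 0) {f : ℕ → ℂ}
    (hf : (Function.support f).Finite) (m : ℕ) :
    abelT Q f m - abelT Q f ((m + 2 : ℕ) : ℤ) =
      (((Q : ℝ) ^ ((m : ℝ) / 2) : ℝ) : ℂ) * (f m - f (m + 2)) := by
  have hQ0 : (0 : ℝ) < Q := by exact_mod_cast Nat.pos_of_ne_zero hQ
  have hQc : (Q : ℂ) ≠ 0 := by exact_mod_cast hQ
  have hconst : (Real.sqrt Q - (Real.sqrt Q)⁻¹) / Real.sqrt Q = 1 - (Q : ℝ)⁻¹ := by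
    have hs : Real.sqrt Q ≠ 0 := (Real.sqrt_pos.2 hQ0).ne'
    rw [sub_div, div_self hs, div_eq_mul_inv, ← mul_inv, Real.mul_self_sqrt hQ0.le]
  have hpow : (Q : ℝ) ^ (((m + 2 : ℕ) : ℝ) / 2) = (Q : ℝ) ^ ((m : ℝ) / 2) * Q := by
    rw [← Real.rpow_add_one hQ0.ne']
    push_cast
    ring_nf
  have htail : ∑' k : ℕ, (((Q : ℝ) ^ ((m : ℝ) / 2 + ((k : ℝ) + 1)) : ℝ) : ℂ) *
        f (m + 2 * (k + 1)) =
      (((Q : ℝ) ^ ((m : ℝ) / 2) : ℝ) : ℂ) * Q * f (m + 2) +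
        ∑' k : ℕ, (((Q : ℝ) ^ (((m + 2 : ℕ) : ℝ) / 2 + ((k : ℝ) + 1)) : ℝ) : ℂ) *
          f (m + 2 + 2 * (k + 1)) := by
    rw [(summable_of_finite_support_comp hf
      (fun a b h => by simpa using h)).tsum_eq_zero_add]
    congr 1
    · simp [Real.rpow_add_one hQ0.ne']
    · refine tsum_congr fun k => ?_
      congr 2
      · push_cast
        ring_nf
      · ring
  simp only [abelT, Int.natAbs_natCast]
  rw [htail, hconst, hpow]
  push_cast
  field_simp
  ring

/-- Inversion of the Abel transform: for every finitely supported `f : ℕ → ℂ`,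
`f(n) = ∑_{k≥0} Q^{-n/2-k} (𝒜f(n+2k) - 𝒜f(n+2k+2))`. -/
theorem abel_inversion (Q : ℕ) (hQ : 2 ≤ Q) (f : ℕ → ℂ)
    (hf : (Function.support f).Finite) (n : ℕ) :
    f n = ∑' k : ℕ, (((Q : ℝ) ^ (-(n : ℝ) / 2 - (k : ℝ)) : ℝ) : ℂ) *
      (abelT Q f ((n : ℤ) + 2 * k) - abelT Q f ((n : ℤ) + 2 * k + 2)) := by
  have hQ0 : (0 : ℝ) < Q := by exact_mod_cast (by omega : 0 < Q)
  have hg : Summable fun k => f (n + 2 * k) := by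
    simpa using summable_of_finite_support_comp (g := fun _ => 1) hf
      (e := fun k => n + 2 * k) (fun a b h => by simpa using h)
  have hterm (k : ℕ) : (((Q : ℝ) ^ (-(n : ℝ) / 2 - (k : ℝ)) : ℝ) : ℂ) *
      (abelT Q f ((n : ℤ) + 2 * k) - abelT Q f ((n : ℤ) + 2 * k + 2)) =
      f (n + 2 * k) - f (n + 2 * (k + 1)) := by
    have h := abelT_sub_abelT_add_two (by omega : Q ≠ 0) hf (n + 2 * k)
    push_cast at h
    rw [h, ← mul_assoc, ← Complex.ofReal_mul, ← Real.rpow_add hQ0]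
    have hexp : -(n : ℝ) / 2 - k + (n + 2 * k) / 2 = 0 := by ring
    rw [hexp, Real.rpow_zero, Complex.ofReal_one, one_mul]
    rfl
  rw [tsum_congr hterm, tsum_sub_succ_of_summable hg, mul_zero, add_zero]
end
end

section
/- (Kunze–Stein phenomenon on trees, Nebbia) For every $1\le r<2$ there exists a constant $C_r>0$ such that for all $f_1\in L^2(\mathbb{T})$ and all radial $f_2\in L^r(\mathbb{T})$ one has $\|f_1*f_2\|_{L^2(\mathbb{T})}\le C_r\,\|f_1\|_{L^2(\mathbb{T})}\,\|f_2\|_{L^r(\mathbb{T})}$. -/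
noncomputable section

open Complex MeasureTheory Filter
open scoped ENNReal NNReal Topology

/-- A homogeneous tree of degree `Q+1`: a connected acyclic graph in which every
vertex has exactly `Q+1` neighbours. -/
structure HomTree (Q : ℕ) : Type 1 where
  V : Type
  graph : SimpleGraph V
  isTree : graph.IsTree
  regular : ∀ x : V, {y : V | graph.Adj x y}.ncard = Q + 1

/-- The sum of `g` over the sphere of radius `n` centred at `x`. -/
def sphereSum {Q : ℕ} (T : HomTree Q) (g : T.V → ℂ) (x : T.V) (n : ℕ) : ℂ :=
  ∑' y : {y : T.V // T.graph.dist x y = n}, g y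

/-- Convolution of `f₁ : 𝕋 → ℂ` with a radial function `f₂ : ℕ → ℂ`:
`f₁ * f₂ (x) = ∑_{n≥0} f₂(n) ∑_{d(x,y)=n} f₁(y)`. -/
def radConv {Q : ℕ} (T : HomTree Q) (f1 : T.V → ℂ) (f2 : ℕ → ℂ) (x : T.V) : ℂ :=
  ∑' n : ℕ, f2 n * sphereSum T f1 x n

/-- The `ℓ^r(𝕋)` norm (valued in `ℝ≥0∞`), `(∑_x |g x|^r)^{1/r}`. -/
def spaceNormR {Q : ℕ} (T : HomTree Q) (r : ℝ) (g : T.V → ℂ) : ℝ≥0∞ :=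
  (∑' x : T.V, (‖g x‖₊ : ℝ≥0∞) ^ r) ^ (1 / r)

/-- The `L^r` norm of a radial function on the tree (valued in `ℝ≥0∞`):
`(|f₂(0)|^r + ∑_{n≥1} (Q+1) Q^{n-1} |f₂(n)|^r)^{1/r}`. -/
def radNorm (Q : ℕ) (r : ℝ) (f2 : ℕ → ℂ) : ℝ≥0∞ :=
  ((‖f2 0‖₊ : ℝ≥0∞) ^ r +
    ∑' n : ℕ, ((Q : ℝ≥0∞) + 1) * (Q : ℝ≥0∞) ^ n * (‖f2 (n + 1)‖₊ : ℝ≥0∞) ^ r) ^ (1 / r)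

namespace SimpleGraph

variable {V : Type*} {G : SimpleGraph V}

open Classical in
/-- The parent of `x` in a tree rooted at `o`: a neighbour of `x` closer to `o`
(and `o` itself when there is none). -/
def parent (G : SimpleGraph V) (o x : V) : V :=
  if h : ∃ w, G.Adj x w ∧ G.dist o x = G.dist o w + 1 then h.choose else x

lemma IsTree.parent_spec (hG : G.IsTree) {o x : V} (hx : x ≠ o) :
    G.Adj x (G.parent o x) ∧ G.dist o x = G.dist o (G.parent o x) + 1 := by
  have h : ∃ w, G.Adj x w ∧ G.dist o x = G.dist o w + 1 := by
    obtain ⟨p, -, hlen⟩ := hG.connected.exists_path_of_dist o x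
    have hnil : ¬p.Nil := Walk.not_nil_of_ne hx.symm
    refine ⟨p.penultimate, (p.adj_penultimate hnil).symm, ?_⟩
    have hadj := p.adj_penultimate hnil
    have hle : G.dist o p.penultimate + 1 ≤ p.length := by
      have h1 := dist_le p.dropLast
      have h2 := Walk.length_dropLast_add_one hnil
      omega
    rcases hG.dist_eq_dist_add_one_of_adj o hadj with h | h <;> omega
  rw [parent, dif_pos h]
  exact h.choose_spec

lemma parent_root (G : SimpleGraph V) (o : V) : G.parent o o = o := by
  rw [parent, dif_neg]
  rintro ⟨w, -, h⟩
  simp at h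

lemma IsTree.eq_of_adj_of_dist_eq (hG : G.IsTree) {o x v w : V}
    (hv : G.Adj x v) (hdv : G.dist o x = G.dist o v + 1)
    (hw : G.Adj x w) (hdw : G.dist o x = G.dist o w + 1) : v = w := by
  classical
  obtain ⟨p, hp, -⟩ := hG.connected.exists_path_of_dist o x
  have key : ∀ u, G.Adj x u → G.dist o x = G.dist o u + 1 → u = p.penultimate := by
    intro u hu hdu
    obtain ⟨q, hq, hlen⟩ := hG.connected.exists_path_of_dist o u
    refine hG.isAcyclic.eq_penultimate_of_adj_end hp hu
      (hG.isAcyclic.mem_support_of_ne_mem_support_of_adj_of_isPath hp hq hu fun hmem => ?_)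
    have h1 := dist_le (q.takeUntil x hmem)
    have h2 := q.length_takeUntil_le_length hmem
    omega
  rw [key v hv hdv, key w hw hdw]

lemma IsTree.parent_eq_of_adj (hG : G.IsTree) {o x w : V} (hw : G.Adj x w)
    (hd : G.dist o x = G.dist o w + 1) : G.parent o x = w := by
  have hx : x ≠ o := by
    rintro rfl
    simp at hd
  obtain ⟨h1, h2⟩ := hG.parent_spec hx
  exact hG.eq_of_adj_of_dist_eq h1 h2 hw hd

lemma IsTree.dist_iterate_parent_le (hG : G.IsTree) (o x : V) (k : ℕ) :
    G.dist x ((G.parent o)^[k] x) ≤ k := by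
  induction k with
  | zero => simp
  | succ k ih =>
    rw [Function.iterate_succ_apply']
    set z := (G.parent o)^[k] x
    have h1 : G.dist z (G.parent o z) ≤ 1 := by
      by_cases hz : z = o
      · rw [hz, parent_root]; simp
      · exact (dist_eq_one_iff_adj.2 (hG.parent_spec hz).1).le
    have := hG.connected.dist_triangle (u := x) (v := z) (w := G.parent o z)
    omega

/-- The vertices lying `j` generations below `z` in a tree rooted at `o`. -/
def descendants (G : SimpleGraph V) (o z : V) (j : ℕ) : Set V :=
  {y | (G.parent o)^[j] y = z ∧ G.dist o y = G.dist o z + j}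

lemma IsTree.exists_mem_descendants (hG : G.IsTree) (o x : V) {y : V} {n : ℕ}
    (h : G.dist x y = n) :
    ∃ i j, i + j = n ∧ y ∈ G.descendants o ((G.parent o)^[i] x) j ∧
      G.dist o x = G.dist o ((G.parent o)^[i] x) + i := by
  induction n generalizing y with
  | zero =>
    obtain rfl := hG.connected.dist_eq_zero_iff.1 h
    exact ⟨0, 0, by simp [descendants]⟩
  | succ n ih =>
    have hyx : y ≠ x := by
      rintro rfl
      simp at h
    obtain ⟨hadj, hd⟩ := hG.parent_spec hyx
    set y' := G.parent x y
    obtain ⟨i, j, hij, ⟨hz, hy'⟩, hx⟩ := ih (y := y') (by omega)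
    rcases hG.dist_eq_dist_add_one_of_adj o hadj with hlt | hlt
    · refine ⟨i, j + 1, by omega, ⟨?_, by omega⟩, hx⟩
      rw [Function.iterate_succ_apply, hG.parent_eq_of_adj hadj hlt, hz]
    · have hpar := hG.parent_eq_of_adj hadj.symm hlt
      rcases j with _ | j
      · have hyi : (G.parent o)^[i + 1] x = y := by
          rw [Function.iterate_succ_apply', ← hz]
          exact hpar
        refine ⟨i + 1, 0, by omega, ⟨by simpa using hyi.symm, by simp [hyi]⟩, ?_⟩
        rw [hyi]
        omega
      · rw [Function.iterate_succ_apply, hpar] at hz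
        have h1 := hG.dist_iterate_parent_le o x i
        have h2 := hG.dist_iterate_parent_le o y j
        rw [hz, dist_comm] at h2
        have := hG.connected.dist_triangle (u := x) (v := (G.parent o)^[i] x) (w := y)
        omega

lemma IsTree.exists_descendants_subset (hG : G.IsTree) {Q : ℕ} (hQ : 1 ≤ Q)
    (hreg : ∀ x : V, {y : V | G.Adj x y}.ncard = Q + 1) (o z : V) (j : ℕ) :
    ∃ s : Finset V, G.descendants o z j ⊆ s ∧ s.card ≤ 2 * Q ^ j := by
  classical
  have hfin : ∀ x : V, {y : V | G.Adj x y}.Finite := fun x =>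
    Set.finite_of_ncard_ne_zero (by rw [hreg]; omega)
  let nb : V → Finset V := fun x => (hfin x).toFinset
  have hnb : ∀ x, (nb x).card = Q + 1 := fun x => by
    rw [← hreg x, Set.ncard_eq_toFinset_card _ (hfin x)]
  have hmem : ∀ x y, y ∈ nb x ↔ G.Adj x y := fun x y => by simp [nb]
  have hstep : ∀ j y, y ∈ G.descendants o z (j + 1) → G.parent o y ∈ G.descendants o z j ∧
      G.Adj (G.parent o y) y ∧ G.dist o y = G.dist o (G.parent o y) + 1 := by
    rintro j y ⟨h1, h2⟩
    have hy : y ≠ o := by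
      rintro rfl
      simp at h2
    obtain ⟨h3, h4⟩ := hG.parent_spec hy
    exact ⟨⟨by rwa [Function.iterate_succ_apply] at h1, by omega⟩, h3.symm, h4⟩
  have hpos : ∀ j, ∃ s : Finset V, G.descendants o z (j + 1) ⊆ s ∧
      s.card ≤ (Q + 1) * Q ^ j := by
    intro j
    induction j with
    | zero =>
      refine ⟨nb z, fun y hy => ?_, by simp [hnb]⟩
      obtain ⟨⟨h1, -⟩, h2, -⟩ := hstep 0 y hy
      rw [Function.iterate_zero_apply] at h1
      rw [h1] at h2
      simpa [hmem] using h2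
    | succ j ih =>
      obtain ⟨s, hs, hcard⟩ := ih
      let t := s.filter (· ≠ o)
      refine ⟨t.biUnion fun w => (nb w).erase (G.parent o w), fun y hy => ?_, ?_⟩
      · obtain ⟨h1, h2, h3⟩ := hstep _ y hy
        have hw : G.parent o y ≠ o := by
          intro h
          have := h1.2
          rw [h] at this
          simp at this
        simp only [Finset.coe_biUnion, Set.mem_iUnion, Finset.mem_coe, exists_prop]
        refine ⟨G.parent o y, Finset.mem_filter.2 ⟨hs h1, hw⟩,
          Finset.mem_erase.2 ⟨fun h => ?_, (hmem _ _).2 h2⟩⟩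
        have h4 := (hG.parent_spec hw).2
        rw [← h] at h4
        omega
      · calc _ ≤ t.card * Q := Finset.card_biUnion_le_card_mul _ _ _ fun w hw => by
              rw [Finset.card_erase_of_mem
                ((hmem _ _).2 (hG.parent_spec (Finset.mem_filter.1 hw).2).1), hnb]
              simp
          _ ≤ (Q + 1) * Q ^ j * Q :=
              Nat.mul_le_mul_right _ ((Finset.card_filter_le _ _).trans hcard)
          _ = (Q + 1) * Q ^ (j + 1) := by ring
  rcases j with _ | j
  · exact ⟨{z}, fun y hy => by simpa using hy.1, by simp⟩
  · obtain ⟨s, hs, hcard⟩ := hpos j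
    refine ⟨s, hs, hcard.trans ?_⟩
    calc (Q + 1) * Q ^ j ≤ (2 * Q) * Q ^ j := Nat.mul_le_mul_right _ (by omega)
      _ = 2 * Q ^ (j + 1) := by ring

end SimpleGraph

lemma ENNReal.sq_tsum_le_tsum_mul_tsum {ι : Type*} {a b c : ι → ℝ≥0∞}
    (h : ∀ i, a i ^ 2 ≤ b i * c i) : (∑' i, a i) ^ 2 ≤ (∑' i, b i) * ∑' i, c i := by
  let m : MeasurableSpace ι := ⊤
  have hhalf : ∀ u : ℝ≥0∞, (u ^ (1 / 2 : ℝ)) ^ (2 : ℝ) = u := fun u => by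
    rw [← ENNReal.rpow_mul]; norm_num
  have hle : ∀ i, a i ≤ b i ^ (1 / 2 : ℝ) * c i ^ (1 / 2 : ℝ) := fun i => by
    rw [← ENNReal.mul_rpow_of_nonneg _ _ (by norm_num),
      ← ENNReal.rpow_le_rpow_iff (z := 2) (by norm_num), hhalf, ENNReal.rpow_two]
    exact h i
  have hcs := ENNReal.lintegral_mul_le_Lp_mul_Lq (Measure.count : Measure ι)
    Real.HolderConjugate.two_two (f := fun i => b i ^ (1 / 2 : ℝ))
    (g := fun i => c i ^ (1 / 2 : ℝ)) measurable_from_top.aemeasurable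
    measurable_from_top.aemeasurable
  simp only [lintegral_count, Pi.mul_apply, hhalf] at hcs
  have := (ENNReal.tsum_le_tsum hle).trans hcs
  rw [← ENNReal.mul_rpow_of_nonneg _ _ (by norm_num),
    ← ENNReal.rpow_le_rpow_iff (z := 2) (by norm_num), hhalf, ENNReal.rpow_two] at this
  exact this

/-- Schur's test for a symmetric kernel with a positive weight. -/
lemma ENNReal.tsum_sq_tsum_mul_le_of_schur {V : Type*} {K : V → V → ℝ≥0∞}
    (hK : ∀ x y, K x y = K y x) {h : V → ℝ≥0∞} (h0 : ∀ x, h x ≠ 0) (htop : ∀ x, h x ≠ ∞)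
    {c : ℝ≥0∞} (hc : ∀ x, ∑' y, K x y * h y ≤ c * h x) (g : V → ℝ≥0∞) :
    ∑' x, (∑' y, K x y * g y) ^ 2 ≤ c ^ 2 * ∑' y, g y ^ 2 := by
  have hcancel : ∀ y, h y * (h y)⁻¹ = 1 := fun y => ENNReal.mul_inv_cancel (h0 y) (htop y)
  calc ∑' x, (∑' y, K x y * g y) ^ 2
      ≤ ∑' x, c * h x * ∑' y, K x y * (g y ^ 2 * (h y)⁻¹) := by
        refine ENNReal.tsum_le_tsum fun x => (ENNReal.sq_tsum_le_tsum_mul_tsum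
          (b := fun y => K x y * h y) (c := fun y => K x y * (g y ^ 2 * (h y)⁻¹))
          fun y => le_of_eq ?_).trans (mul_le_mul_left (hc x) _)
        calc (K x y * g y) ^ 2 = (K x y * g y) ^ 2 * (h y * (h y)⁻¹) := by
              rw [hcancel, mul_one]
          _ = _ := by ring
    _ = c * ∑' x, ∑' y, g y ^ 2 * (h y)⁻¹ * (K y x * h x) := by
        rw [← ENNReal.tsum_mul_left]
        refine tsum_congr fun x => ?_
        rw [mul_assoc, ← ENNReal.tsum_mul_left]
        congr 1
        refine tsum_congr fun y => ?_
        rw [hK x y]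
        ring
    _ = c * ∑' y, g y ^ 2 * (h y)⁻¹ * ∑' x, K y x * h x := by
        rw [ENNReal.tsum_comm]
        simp_rw [ENNReal.tsum_mul_left]
    _ ≤ c * ∑' y, g y ^ 2 * (h y)⁻¹ * (c * h y) := by
        gcongr with y
        exact hc y
    _ = c ^ 2 * ∑' y, g y ^ 2 := by
        rw [sq, mul_assoc, ← ENNReal.tsum_mul_left (a := c) (f := fun y => g y ^ 2)]
        congr 1
        refine tsum_congr fun y => ?_
        calc g y ^ 2 * (h y)⁻¹ * (c * h y) = c * g y ^ 2 * (h y * (h y)⁻¹) := by ring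
          _ = _ := by rw [hcancel, mul_one]

namespace SimpleGraph

variable {V : Type*} {G : SimpleGraph V}

lemma IsTree.tsum_descendants_le (hG : G.IsTree) {Q : ℕ} (hQ : 1 ≤ Q)
    (hreg : ∀ x : V, {y : V | G.Adj x y}.ncard = Q + 1) {q : ℝ≥0∞} (hq0 : q ≠ 0)
    (hqtop : q ≠ ∞) (hq : q ^ 2 = Q) (o z : V) (j : ℕ) :
    ∑' y : G.descendants o z j, q⁻¹ ^ G.dist o y ≤ 2 * q ^ j * q⁻¹ ^ G.dist o z := by
  obtain ⟨s, hs, hcard⟩ := hG.exists_descendants_subset hQ hreg o z j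
  have hcast : (s.card : ℝ≥0∞) ≤ 2 * (q ^ 2) ^ j := by
    rw [hq]
    exact_mod_cast hcard
  calc ∑' y : G.descendants o z j, q⁻¹ ^ G.dist o y
      = ∑' _ : G.descendants o z j, q⁻¹ ^ (G.dist o z + j) :=
        tsum_congr fun y => by rw [y.2.2]
    _ ≤ ∑' _ : (s : Set V), q⁻¹ ^ (G.dist o z + j) :=
        ENNReal.tsum_mono_subtype (fun _ => q⁻¹ ^ (G.dist o z + j)) hs
    _ = s.card * q⁻¹ ^ (G.dist o z + j) := by simp
    _ ≤ 2 * (q ^ 2) ^ j * q⁻¹ ^ (G.dist o z + j) := by gcongr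
    _ = 2 * q ^ j * q⁻¹ ^ G.dist o z * (q * q⁻¹) ^ j := by ring
    _ = _ := by rw [ENNReal.mul_inv_cancel hq0 hqtop, one_pow, mul_one]

lemma IsTree.tsum_sphere_le (hG : G.IsTree) {Q : ℕ} (hQ : 1 ≤ Q)
    (hreg : ∀ x : V, {y : V | G.Adj x y}.ncard = Q + 1) {q : ℝ≥0∞} (hq0 : q ≠ 0)
    (hqtop : q ≠ ∞) (hq : q ^ 2 = Q) (o x : V) (n : ℕ) :
    ∑' y : {y // G.dist x y = n}, q⁻¹ ^ G.dist o y ≤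
      2 * (n + 1) * q ^ n * q⁻¹ ^ G.dist o x := by
  classical
  let I := (Finset.range (n + 1)).filter fun i =>
    G.dist o x = G.dist o ((G.parent o)^[i] x) + i
  have hsub : {y | G.dist x y = n} ⊆
      ⋃ i ∈ I, G.descendants o ((G.parent o)^[i] x) (n - i) := by
    intro y hy
    obtain ⟨i, j, hij, hmem, hx⟩ := hG.exists_mem_descendants o x hy
    obtain rfl : j = n - i := by omega
    simp only [Set.mem_iUnion, exists_prop]
    exact ⟨i, Finset.mem_filter.2 ⟨Finset.mem_range.2 (by omega), hx⟩, hmem⟩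
  calc _ ≤ _ := ENNReal.tsum_mono_subtype (fun y => q⁻¹ ^ G.dist o y) hsub
    _ ≤ ∑ i ∈ I, ∑' y : G.descendants o ((G.parent o)^[i] x) (n - i), q⁻¹ ^ G.dist o y :=
        ENNReal.tsum_biUnion_le (fun y => q⁻¹ ^ G.dist o y) I _
    _ ≤ ∑ _i ∈ I, 2 * q ^ n * q⁻¹ ^ G.dist o x := by
        refine Finset.sum_le_sum fun i hi => ?_
        obtain ⟨hin, hx⟩ := Finset.mem_filter.1 hi
        have hin := Finset.mem_range.1 hin
        refine (hG.tsum_descendants_le hQ hreg hq0 hqtop hq o _ _).trans_eq ?_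
        calc _ = 2 * q ^ (n - i) * q⁻¹ ^ G.dist o ((G.parent o)^[i] x) * (q * q⁻¹) ^ i := by
              rw [ENNReal.mul_inv_cancel hq0 hqtop, one_pow, mul_one]
          _ = 2 * (q ^ (n - i) * q ^ i) *
              (q⁻¹ ^ G.dist o ((G.parent o)^[i] x) * q⁻¹ ^ i) := by ring
          _ = _ := by rw [← pow_add, ← pow_add, ← hx, Nat.sub_add_cancel (by omega)]
    _ = I.card * (2 * q ^ n * q⁻¹ ^ G.dist o x) := by simp
    _ ≤ (n + 1 : ℕ) * (2 * q ^ n * q⁻¹ ^ G.dist o x) := by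
        gcongr
        exact (Finset.card_filter_le _ _).trans_eq (Finset.card_range _)
    _ = _ := by push_cast; ring

/-- Summation over the spheres centred at `x`. -/
lemma tsum_mul_tsum_sphere (G : SimpleGraph V) (x : V) (a : ℕ → ℝ≥0∞) (g : V → ℝ≥0∞) :
    ∑' n, a n * ∑' y : {y // G.dist x y = n}, g y = ∑' y, a (G.dist x y) * g y := by
  rw [← (Equiv.sigmaFiberEquiv fun y => G.dist x y).tsum_eq, ENNReal.tsum_sigma']
  refine tsum_congr fun n => ?_
  rw [← ENNReal.tsum_mul_left]
  refine tsum_congr fun y => ?_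
  simp [Equiv.sigmaFiberEquiv, y.2]

lemma IsTree.tsum_sq_tsum_dist_mul_le (hG : G.IsTree) {Q : ℕ} (hQ : 1 ≤ Q)
    (hreg : ∀ x : V, {y : V | G.Adj x y}.ncard = Q + 1) {q : ℝ≥0∞} (hq0 : q ≠ 0)
    (hqtop : q ≠ ∞) (hq : q ^ 2 = Q) (a : ℕ → ℝ≥0∞) (g : V → ℝ≥0∞) :
    ∑' x, (∑' y, a (G.dist x y) * g y) ^ 2 ≤
      (∑' n, a n * (2 * (n + 1) * q ^ n)) ^ 2 * ∑' y, g y ^ 2 := by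
  obtain ⟨o⟩ := hG.connected.nonempty
  refine ENNReal.tsum_sq_tsum_mul_le_of_schur (K := fun x y => a (G.dist x y))
    (fun x y => by rw [dist_comm]) (h := fun x => q⁻¹ ^ G.dist o x)
    (fun x => pow_ne_zero _ (ENNReal.inv_ne_zero.2 hqtop))
    (fun x => ENNReal.pow_ne_top (ENNReal.inv_ne_top.2 hq0)) (fun x => ?_) g
  rw [← tsum_mul_tsum_sphere G x a fun y => q⁻¹ ^ G.dist o y, ← ENNReal.tsum_mul_right]
  refine ENNReal.tsum_le_tsum fun n => ?_
  rw [mul_assoc]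
  gcongr
  exact hG.tsum_sphere_le hQ hreg hq0 hqtop hq o x n

end SimpleGraph

lemma enorm_radConv_le {Q : ℕ} (T : HomTree Q) (f1 : T.V → ℂ) (f2 : ℕ → ℂ) (x : T.V) :
    ‖radConv T f1 f2 x‖ₑ ≤ ∑' y, ‖f2 (T.graph.dist x y)‖ₑ * ‖f1 y‖ₑ := by
  rw [← T.graph.tsum_mul_tsum_sphere x (fun n => ‖f2 n‖ₑ) fun y => ‖f1 y‖ₑ]
  refine enorm_tsum_le_tsum_enorm.trans (ENNReal.tsum_le_tsum fun n => ?_)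
  rw [enorm_mul]
  gcongr
  exact enorm_tsum_le_tsum_enorm

lemma enorm_mul_rpow_le_radNorm {Q : ℕ} {r : ℝ} (hr : 0 < r) (f2 : ℕ → ℂ) (n : ℕ) :
    ‖f2 n‖ₑ * ((Q : ℝ≥0∞) ^ (1 / r)) ^ n ≤ radNorm Q r f2 := by
  rw [← ENNReal.rpow_le_rpow_iff hr, radNorm, ← ENNReal.rpow_mul, one_div,
    inv_mul_cancel₀ hr.ne', ENNReal.rpow_one, ENNReal.mul_rpow_of_nonneg _ _ hr.le,
    ← ENNReal.rpow_natCast, ← ENNReal.rpow_mul, ← ENNReal.rpow_mul,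
    show r⁻¹ * ((n : ℝ) * r) = n by field_simp, ENNReal.rpow_natCast]
  rcases n with _ | n
  · rw [pow_zero, mul_one]
    exact le_self_add
  · refine le_trans ?_ le_add_self
    refine le_trans ?_ (ENNReal.le_tsum n)
    rw [mul_comm, pow_succ']
    change _ * (‖f2 (n + 1)‖ₑ) ^ r ≤ _ * (‖f2 (n + 1)‖ₑ) ^ r
    gcongr
    exact le_self_add

lemma ENNReal.tsum_succ_mul_pow_ne_top {t : ℝ≥0∞} (ht : t < 1) :
    ∑' n : ℕ, ((n : ℝ≥0∞) + 1) * t ^ n ≠ ∞ := by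
  lift t to ℝ≥0 using ht.ne_top
  have ht' : ‖(t : ℝ)‖ < 1 := by simpa using ht
  have h1 : Summable fun n : ℕ => ((n : ℝ) + 1) * (t : ℝ) ^ n := by
    simpa [add_mul] using (summable_pow_mul_geometric_of_norm_lt_one 1 ht').add
      (summable_geometric_of_norm_lt_one ht')
  have h2 : Summable fun n : ℕ => ((n : ℝ≥0) + 1) * t ^ n := by
    rw [← NNReal.summable_coe]
    simpa using h1
  simpa using ENNReal.tsum_coe_ne_top_iff_summable.2 h2

/-- Kunze–Stein phenomenon on trees (Nebbia): for `1 ≤ r < 2`,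
`L²(𝕋) * L^r(𝕋)^♯ ⊆ L²(𝕋)`, with
`‖f₁*f₂‖_{L²} ≤ C_r ‖f₁‖_{L²} ‖f₂‖_{L^r}`. -/
theorem kunze_stein (Q : ℕ) (hQ : 2 ≤ Q) (T : HomTree Q) (r : ℝ)
    (hr1 : 1 ≤ r) (hr2 : r < 2) :
    ∃ C : ℝ≥0, 0 < C ∧ ∀ (f1 : T.V → ℂ) (f2 : ℕ → ℂ),
      spaceNormR T 2 (radConv T f1 f2) ≤
        (C : ℝ≥0∞) * spaceNormR T 2 f1 * radNorm Q r f2 := by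
  have hQ0 : (Q : ℝ≥0∞) ≠ 0 := by simp; omega
  have hQtop : (Q : ℝ≥0∞) ≠ ∞ := by simp
  have hr0 : 0 < r := by linarith
  set q : ℝ≥0∞ := (Q : ℝ≥0∞) ^ (1 / 2 : ℝ) with hqdef
  set p : ℝ≥0∞ := (Q : ℝ≥0∞) ^ (1 / r) with hpdef
  have hq0 : q ≠ 0 := by simp [hqdef, hQ0]
  have hqtop : q ≠ ∞ := ENNReal.rpow_ne_top_of_nonneg (by norm_num) hQtop
  have hp0 : p ≠ 0 := by simp [hpdef, hQ0]
  have hptop : p ≠ ∞ := ENNReal.rpow_ne_top_of_nonneg (by positivity) hQtop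
  have hq2 : q ^ 2 = Q := by
    rw [hqdef, ← ENNReal.rpow_two, ← ENNReal.rpow_mul]
    norm_num
  have hqp : q < p := by
    refine ENNReal.rpow_lt_rpow_of_exponent_lt ?_ hQtop (one_div_lt_one_div_of_lt hr0 hr2)
    exact_mod_cast hQ
  have ht : q / p < 1 := by
    rw [ENNReal.div_lt_iff (Or.inl hp0) (Or.inl hptop), one_mul]
    exact hqp
  set S : ℝ≥0∞ := ∑' n : ℕ, ((n : ℝ≥0∞) + 1) * (q / p) ^ n with hS
  have hStop : S ≠ ∞ := ENNReal.tsum_succ_mul_pow_ne_top ht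
  refine ⟨2 * S.toNNReal + 1, by positivity, fun f1 f2 => ?_⟩
  have hlam : ∑' n : ℕ, ‖f2 n‖ₑ * (2 * (n + 1) * q ^ n) ≤ 2 * S * radNorm Q r f2 := by
    rw [hS, ← ENNReal.tsum_mul_left, ← ENNReal.tsum_mul_right]
    refine ENNReal.tsum_le_tsum fun n => ?_
    calc ‖f2 n‖ₑ * (2 * (n + 1) * q ^ n)
        = ‖f2 n‖ₑ * (2 * (n + 1) * q ^ n) * (p * p⁻¹) ^ n := by
          rw [ENNReal.mul_inv_cancel hp0 hptop, one_pow, mul_one]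
      _ = 2 * ((n + 1) * (q / p) ^ n) * (‖f2 n‖ₑ * p ^ n) := by
          rw [div_eq_mul_inv]
          ring
      _ ≤ _ := by
          gcongr
          exact enorm_mul_rpow_le_radNorm hr0 f2 n
  have hsq : ∑' x, ‖radConv T f1 f2 x‖ₑ ^ 2 ≤
      (2 * S * radNorm Q r f2) ^ 2 * ∑' x, ‖f1 x‖ₑ ^ 2 :=
    calc _ ≤ ∑' x, (∑' y, ‖f2 (T.graph.dist x y)‖ₑ * ‖f1 y‖ₑ) ^ 2 := by
          gcongr with x
          exact enorm_radConv_le T f1 f2 x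
      _ ≤ _ := T.isTree.tsum_sq_tsum_dist_mul_le (by omega) T.regular hq0 hqtop hq2
          (fun n => ‖f2 n‖ₑ) fun y => ‖f1 y‖ₑ
      _ ≤ _ := by gcongr
  have hnorm : ∀ g : T.V → ℂ, spaceNormR T 2 g ^ (2 : ℝ) = ∑' x, ‖g x‖ₑ ^ 2 := fun g => by
    rw [spaceNormR, ← ENNReal.rpow_mul]
    norm_num
    rfl
  calc spaceNormR T 2 (radConv T f1 f2)
      ≤ 2 * S * radNorm Q r f2 * spaceNormR T 2 f1 := by
        rw [← ENNReal.rpow_le_rpow_iff (z := 2) (by norm_num),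
          ENNReal.mul_rpow_of_nonneg _ _ (by norm_num), hnorm, hnorm, ENNReal.rpow_two]
        exact hsq
    _ = 2 * S * spaceNormR T 2 f1 * radNorm Q r f2 := by ring
    _ ≤ _ := by
        gcongr
        push_cast
        rw [ENNReal.coe_toNNReal hStop]
        exact le_self_add
end
end

section
/- Let $c>0$ be a fixed constant and set $J(t,m)=\int_0^{\pi}e^{ict\cos\lambda}\,\cos(m\lambda)\,d\lambda$. Then there exists a constant $C>0$ such that $|J(t,m)|\le C\,|t|^{-1/2}\,(1+m)$ for every $m\in\mathbb{N}$ and every $t\in\mathbb{R}$ with $|t|\ge1$. -/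
noncomputable section

open Complex MeasureTheory Filter
open scoped ENNReal NNReal Topology

/-- The derivative of `sin l * cos (m l) / (sin² l + η²)`. -/
def weightDeriv (m η l : ℝ) : ℝ :=
  ((Real.cos l * Real.cos (m * l) - m * Real.sin l * Real.sin (m * l)) *
      (Real.sin l ^ 2 + η ^ 2) -
    Real.sin l * Real.cos (m * l) * (2 * Real.sin l * Real.cos l)) /
      (Real.sin l ^ 2 + η ^ 2) ^ 2

lemma hasDerivAt_weight (m : ℝ) {η : ℝ} (hη : 0 < η) (l : ℝ) :
    HasDerivAt (fun x : ℝ => Real.sin x * Real.cos (m * x) / (Real.sin x ^ 2 + η ^ 2))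
      (weightDeriv m η l) l := by
  have hD : Real.sin l ^ 2 + η ^ 2 ≠ 0 := by positivity
  have hm : HasDerivAt (fun x : ℝ => m * x) m l := by
    simpa using (hasDerivAt_id l).const_mul m
  have h := ((Real.hasDerivAt_sin l).mul hm.cos).div
    (((Real.hasDerivAt_sin l).pow 2).add_const (η ^ 2)) hD
  refine h.congr_deriv ?_
  simp only [weightDeriv, Pi.mul_apply, Pi.pow_apply]
  congr 1
  push_cast
  ring

lemma continuous_weightDeriv (m : ℝ) {η : ℝ} (hη : 0 < η) : Continuous (weightDeriv m η) := by
  unfold weightDeriv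
  refine Continuous.div (by fun_prop) (by fun_prop) fun l => ?_
  positivity

lemma abs_weightDeriv_le {m η : ℝ} (hm : 0 ≤ m) (hη : 0 < η) (l : ℝ) :
    |weightDeriv m η l| ≤ 1 / (Real.sin l ^ 2 + η ^ 2) + m / (2 * η) := by
  have hD : 0 < Real.sin l ^ 2 + η ^ 2 := by positivity
  have hsplit : weightDeriv m η l =
      (Real.cos l * Real.cos (m * l)) * (η ^ 2 - Real.sin l ^ 2) / (Real.sin l ^ 2 + η ^ 2) ^ 2 -
        m * (Real.sin l * Real.sin (m * l)) / (Real.sin l ^ 2 + η ^ 2) := by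
    unfold weightDeriv
    field_simp
    ring
  have hcos : |Real.cos l * Real.cos (m * l)| ≤ 1 := by
    rw [abs_mul]
    exact mul_le_one₀ (Real.abs_cos_le_one _) (abs_nonneg _) (Real.abs_cos_le_one _)
  have hdiff : |η ^ 2 - Real.sin l ^ 2| ≤ Real.sin l ^ 2 + η ^ 2 := by
    rw [abs_le]
    constructor <;> nlinarith [sq_nonneg η, sq_nonneg (Real.sin l)]
  have hsin : |Real.sin l * Real.sin (m * l)| ≤ |Real.sin l| := by
    rw [abs_mul]
    exact mul_le_of_le_one_right (abs_nonneg _) (Real.abs_sin_le_one _)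
  rw [hsplit]
  refine (abs_sub _ _).trans (add_le_add ?_ ?_)
  · rw [abs_div, abs_mul, abs_of_pos (pow_pos hD 2), div_le_div_iff₀ (pow_pos hD 2) hD]
    have := mul_le_mul hcos hdiff (abs_nonneg _) zero_le_one
    nlinarith
  · rw [abs_div, abs_mul, abs_of_pos hD, abs_of_nonneg hm, div_le_div_iff₀ hD (by positivity)]
    have h1 := mul_le_mul_of_nonneg_left hsin hm
    have h2 : |Real.sin l| * (2 * η) ≤ Real.sin l ^ 2 + η ^ 2 := by
      nlinarith [sq_nonneg (|Real.sin l| - η), sq_abs (Real.sin l)]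
    nlinarith [mul_le_mul_of_nonneg_left h2 hm]

lemma one_div_sin_sq_add_le {η : ℝ} (hη : 0 < η) {l : ℝ} (h0 : 0 ≤ l) (hl : l ≤ Real.pi) :
    1 / (Real.sin l ^ 2 + η ^ 2) ≤
      1 / (l ^ 2 / 4 + η ^ 2) + 1 / ((Real.pi - l) ^ 2 / 4 + η ^ 2) := by
  have key : ∀ x : ℝ, 0 ≤ x → x ≤ Real.pi / 2 →
      1 / (Real.sin x ^ 2 + η ^ 2) ≤ 1 / (x ^ 2 / 4 + η ^ 2) := by
    intro x hx hx'
    have h1 : x / 2 ≤ Real.sin x := by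
      refine le_trans ?_ (Real.mul_le_sin hx hx')
      rw [div_mul_eq_mul_div, div_le_div_iff₀ two_pos Real.pi_pos]
      nlinarith [Real.pi_le_four]
    refine one_div_le_one_div_of_le (by positivity) ?_
    nlinarith
  rcases le_total l (Real.pi / 2) with h | h
  · exact (key l h0 h).trans (le_add_of_nonneg_right (by positivity))
  · have := key (Real.pi - l) (by linarith) (by linarith)
    rw [Real.sin_pi_sub] at this
    exact this.trans (le_add_of_nonneg_left (by positivity))

lemma hasDerivAt_arctan_div {η : ℝ} (hη : 0 < η) (x : ℝ) :
    HasDerivAt (fun y : ℝ => 2 / η * Real.arctan (y / (2 * η))) (1 / (x ^ 2 / 4 + η ^ 2)) x := by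
  have h := (((hasDerivAt_id x).div_const (2 * η)).arctan).const_mul (2 / η)
  refine h.congr_deriv ?_
  simp only [id]
  field_simp
  ring

lemma integral_one_div_sq_add_le {η : ℝ} (hη : 0 < η) :
    ∫ l in (0 : ℝ)..Real.pi, 1 / (l ^ 2 / 4 + η ^ 2) ≤ Real.pi / η := by
  have hc : Continuous fun l : ℝ => 1 / (l ^ 2 / 4 + η ^ 2) :=
    continuous_const.div (by fun_prop) fun l => by positivity
  rw [intervalIntegral.integral_eq_sub_of_hasDerivAt
    (fun x _ => hasDerivAt_arctan_div hη x) (hc.intervalIntegrable _ _)]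
  have h := mul_le_mul_of_nonneg_left (Real.arctan_lt_pi_div_two (Real.pi / (2 * η))).le
    (by positivity : 0 ≤ 2 / η)
  have h2 : 2 / η * (Real.pi / 2) = Real.pi / η := by field_simp
  simpa [h2] using h

lemma integral_one_div_sin_sq_add_le {η : ℝ} (hη : 0 < η) :
    ∫ l in (0 : ℝ)..Real.pi, 1 / (Real.sin l ^ 2 + η ^ 2) ≤ 2 * Real.pi / η := by
  have hs : Continuous fun l : ℝ => 1 / (Real.sin l ^ 2 + η ^ 2) :=
    continuous_const.div (by fun_prop) fun l => by positivity
  have hc : Continuous fun l : ℝ => 1 / (l ^ 2 / 4 + η ^ 2) :=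
    continuous_const.div (by fun_prop) fun l => by positivity
  have hc' : Continuous fun l : ℝ => 1 / ((Real.pi - l) ^ 2 / 4 + η ^ 2) :=
    continuous_const.div (by fun_prop) fun l => by positivity
  have hrefl : ∫ l in (0 : ℝ)..Real.pi, 1 / ((Real.pi - l) ^ 2 / 4 + η ^ 2) =
      ∫ l in (0 : ℝ)..Real.pi, 1 / (l ^ 2 / 4 + η ^ 2) := by
    rw [intervalIntegral.integral_comp_sub_left (fun l : ℝ => 1 / (l ^ 2 / 4 + η ^ 2)) Real.pi,
      sub_self, sub_zero]
  calc ∫ l in (0 : ℝ)..Real.pi, 1 / (Real.sin l ^ 2 + η ^ 2)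
      ≤ ∫ l in (0 : ℝ)..Real.pi,
          (1 / (l ^ 2 / 4 + η ^ 2) + 1 / ((Real.pi - l) ^ 2 / 4 + η ^ 2)) :=
        intervalIntegral.integral_mono_on Real.pi_pos.le (hs.intervalIntegrable _ _)
          ((hc.add hc').intervalIntegrable _ _)
          fun l hl => one_div_sin_sq_add_le hη hl.1 hl.2
    _ ≤ Real.pi / η + Real.pi / η := by
        rw [intervalIntegral.integral_add (hc.intervalIntegrable _ _)
          (hc'.intervalIntegrable _ _), hrefl]
        exact add_le_add (integral_one_div_sq_add_le hη) (integral_one_div_sq_add_le hη)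
    _ = 2 * Real.pi / η := by ring

/-- Integration by parts against a weight vanishing at both stationary points of the phase. -/
lemma integral_exp_cos_by_parts (m : ℝ) {T η : ℝ} (hη : 0 < η) :
    (I * T : ℂ) * ∫ l in (0 : ℝ)..Real.pi,
        exp (I * T * Real.cos l) * (Real.cos (m * l) : ℂ) =
      ∫ l in (0 : ℝ)..Real.pi, exp (I * T * Real.cos l) *
        ((weightDeriv m η l : ℂ) +
          I * ((T * η ^ 2 * Real.cos (m * l) / (Real.sin l ^ 2 + η ^ 2) : ℝ) : ℂ)) := by
  set g : ℝ → ℝ := fun x => Real.sin x * Real.cos (m * x) / (Real.sin x ^ 2 + η ^ 2) with hg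
  have hderiv (l : ℝ) : HasDerivAt (fun x : ℝ => exp (I * T * Real.cos x) * (g x : ℂ))
      (exp (I * T * Real.cos l) * ((weightDeriv m η l : ℂ) +
          I * ((T * η ^ 2 * Real.cos (m * l) / (Real.sin l ^ 2 + η ^ 2) : ℝ) : ℂ)) -
        I * T * (exp (I * T * Real.cos l) * (Real.cos (m * l) : ℂ))) l := by
    have h := (((Real.hasDerivAt_cos l).ofReal_comp.const_mul (I * T : ℂ)).cexp).mul
      (hasDerivAt_weight m hη l).ofReal_comp
    refine h.congr_deriv ?_
    have hD : Real.sin l ^ 2 + η ^ 2 ≠ 0 := by positivity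
    have hreal : T * η ^ 2 * Real.cos (m * l) / (Real.sin l ^ 2 + η ^ 2) =
        T * Real.cos (m * l) -
          T * Real.sin l * (Real.sin l * Real.cos (m * l) / (Real.sin l ^ 2 + η ^ 2)) := by
      field_simp
      ring
    rw [hreal]
    push_cast
    ring
  have hc : Continuous fun l : ℝ => exp (I * T * Real.cos l) * ((weightDeriv m η l : ℂ) +
      I * ((T * η ^ 2 * Real.cos (m * l) / (Real.sin l ^ 2 + η ^ 2) : ℝ) : ℂ)) := by
    have h1 := continuous_weightDeriv m hη
    have h2 : Continuous fun l : ℝ =>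
        T * η ^ 2 * Real.cos (m * l) / (Real.sin l ^ 2 + η ^ 2) :=
      Continuous.div (by fun_prop) (by fun_prop) fun l => by positivity
    fun_prop
  have hc' : Continuous fun l : ℝ =>
      I * T * (exp (I * T * Real.cos l) * (Real.cos (m * l) : ℂ)) := by fun_prop
  have h := intervalIntegral.integral_eq_sub_of_hasDerivAt (a := 0) (b := Real.pi)
    (fun x _ => hderiv x) ((hc.sub hc').intervalIntegrable _ _)
  rw [intervalIntegral.integral_sub (hc.intervalIntegrable _ _) (hc'.intervalIntegrable _ _),
    intervalIntegral.integral_const_mul] at h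
  simp only [hg, Real.sin_pi, Real.sin_zero, zero_mul, zero_div, ofReal_zero, mul_zero,
    sub_zero] at h
  exact (sub_eq_zero.mp h).symm

lemma norm_integral_exp_cos_le {m T η : ℝ} (hm : 0 ≤ m) (hη : 0 < η) (hT : |T| * η ^ 2 = 1) :
    ‖∫ l in (0 : ℝ)..Real.pi, exp (I * T * Real.cos l) * (Real.cos (m * l) : ℂ)‖ ≤
      4 * Real.pi * η * (1 + m) := by
  have hs : Continuous fun l : ℝ => 1 / (Real.sin l ^ 2 + η ^ 2) :=
    continuous_const.div (by fun_prop) fun l => by positivity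
  have hb : Continuous fun l : ℝ => 2 * (1 / (Real.sin l ^ 2 + η ^ 2)) + m / (2 * η) := by
    fun_prop
  have hpoint (l : ℝ) : ‖exp (I * T * Real.cos l) * ((weightDeriv m η l : ℂ) +
      I * ((T * η ^ 2 * Real.cos (m * l) / (Real.sin l ^ 2 + η ^ 2) : ℝ) : ℂ))‖ ≤
      2 * (1 / (Real.sin l ^ 2 + η ^ 2)) + m / (2 * η) := by
    have hexp : ‖exp (I * T * Real.cos l)‖ = 1 := by
      rw [mul_assoc, mul_comm, ← ofReal_mul, norm_exp_ofReal_mul_I]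
    have hD : 0 < Real.sin l ^ 2 + η ^ 2 := by positivity
    rw [norm_mul, hexp, one_mul]
    refine (norm_add_le _ _).trans ?_
    rw [norm_mul, norm_I, one_mul, norm_real, norm_real, Real.norm_eq_abs, Real.norm_eq_abs]
    have h1 := abs_weightDeriv_le hm hη l
    have h2 : |T * η ^ 2 * Real.cos (m * l) / (Real.sin l ^ 2 + η ^ 2)| ≤
        1 / (Real.sin l ^ 2 + η ^ 2) := by
      rw [abs_div, abs_mul, abs_mul, abs_of_pos hD, abs_of_nonneg (sq_nonneg η), hT, one_mul]
      gcongr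
      exact Real.abs_cos_le_one _
    linarith
  have hint := intervalIntegral.norm_integral_le_of_norm_le (μ := volume) Real.pi_pos.le
    (ae_of_all _ fun l _ => hpoint l) (hb.intervalIntegrable _ _)
  rw [← integral_exp_cos_by_parts m hη, norm_mul, norm_mul, norm_I, one_mul, norm_real,
    Real.norm_eq_abs,
    intervalIntegral.integral_add ((hs.const_mul 2).intervalIntegrable _ _)
      (continuous_const.intervalIntegrable _ _),
    intervalIntegral.integral_const_mul, intervalIntegral.integral_const, sub_zero,
    smul_eq_mul] at hint
  set N := ‖∫ l in (0 : ℝ)..Real.pi, exp (I * T * Real.cos l) * (Real.cos (m * l) : ℂ)‖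
  have hscaled : |T| * N ≤ 4 * Real.pi * (1 + m) / η := by
    refine hint.trans ?_
    have hK := integral_one_div_sin_sq_add_le hη
    have hsum : 2 * (2 * Real.pi / η) + Real.pi * (m / (2 * η)) =
        4 * Real.pi * (1 + m / 8) / η := by
      field_simp
      ring
    have hle : 4 * Real.pi * (1 + m / 8) / η ≤ 4 * Real.pi * (1 + m) / η := by
      gcongr
      linarith
    linarith
  calc N = η ^ 2 * (|T| * N) := by linear_combination (-N) * hT
    _ ≤ η ^ 2 * (4 * Real.pi * (1 + m) / η) := by gcongr
    _ = 4 * Real.pi * η * (1 + m) := by field_simp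

/-- Oscillatory integral estimate: for fixed `c > 0` and
`J(t,m) = ∫₀^π e^{ict cos λ} cos(mλ) dλ`, there is `C > 0` with
`|J(t,m)| ≤ C |t|^{-1/2} (1+m)` for all `m ∈ ℕ` and all real `t` with `|t| ≥ 1`. -/
theorem oscillatory_integral_estimate (c : ℝ) (hc : 0 < c) :
    ∃ C : ℝ, 0 < C ∧ ∀ (m : ℕ) (t : ℝ), 1 ≤ |t| →
      ‖∫ l in (0 : ℝ)..Real.pi,
          Complex.exp (Complex.I * c * t * Real.cos l) * (Real.cos ((m : ℝ) * l) : ℂ)‖ ≤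
        C * |t| ^ (-(1 / 2) : ℝ) * (1 + (m : ℝ)) := by
  refine ⟨4 * Real.pi * c ^ (-(1 / 2) : ℝ), by positivity, fun m t ht => ?_⟩
  have ht0 : 0 < |t| := one_pos.trans_le ht
  have hη : 0 < (c * |t|) ^ (-(1 / 2) : ℝ) := by positivity
  have hT : |c * t| * ((c * |t|) ^ (-(1 / 2) : ℝ)) ^ 2 = 1 := by
    rw [abs_mul, abs_of_pos hc, ← Real.rpow_mul_natCast (by positivity)]
    norm_num [Real.rpow_neg_one]
    field_simp
  have h := norm_integral_exp_cos_le (Nat.cast_nonneg m) hη hT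
  rw [Real.mul_rpow hc.le ht0.le] at h
  simpa only [ofReal_mul, mul_assoc] using h
end
end

section
/- The Schrödinger kernel satisfies the pointwise estimates: there exists a constant $C>0$ (depending only on $Q$) such that for all $n\in\mathbb{N}$, $|s_t(n)|\le C\,Q^{-n/2}$ if $|t|<1$, and $|s_t(n)|\le C\,|t|^{-3/2}\,(1+n)^2\,Q^{-n/2}$ if $|t|\ge1$. -/
noncomputable section

open Complex MeasureTheory Filter
open scoped ENNReal NNReal Topology

/-- `γ(0) = 2/(Q^{1/2} + Q^{-1/2})`. -/
def gammaZero (Q : ℕ) : ℝ := 2 / (Real.sqrt Q + (Real.sqrt Q)⁻¹)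

/-- The radial Schrödinger kernel
`s_t(n) = e^{it} (2/π) ∑_{k≥0} Q^{-n/2-k} ∫₀^π e^{-iγ(0)t cos λ} sin λ sin((n+2k+1)λ) dλ`. -/
def schKernel (Q : ℕ) (t : ℝ) (n : ℕ) : ℂ :=
  Complex.exp (Complex.I * t) * (2 / Real.pi) *
    ∑' k : ℕ, (((Q : ℝ) ^ (-(n : ℝ) / 2 - (k : ℝ)) : ℝ) : ℂ) *
      ∫ l in (0 : ℝ)..Real.pi,
        Complex.exp (-Complex.I * (gammaZero Q) * t * Real.cos l) *
          (Real.sin l : ℂ) * (Real.sin (((n : ℝ) + 2 * k + 1) * l) : ℂ)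

/-- The oscillating factor `e^{-is cos l}`. -/
def cosPhase (s l : ℝ) : ℂ := Complex.exp (-Complex.I * s * Real.cos l)

lemma norm_cosPhase (s l : ℝ) : ‖cosPhase s l‖ = 1 := by
  have h : -Complex.I * (s : ℂ) * (Real.cos l : ℂ) = ((-(s * Real.cos l) : ℝ) : ℂ) * Complex.I := by
    push_cast; ring
  rw [cosPhase, h, Complex.norm_exp_ofReal_mul_I]

lemma hasDerivAt_cosPhase (s l : ℝ) :
    HasDerivAt (cosPhase s) (Complex.I * s * Real.sin l * cosPhase s l) l := by
  have h := (((Real.hasDerivAt_cos l).ofReal_comp).const_mul (-Complex.I * (s : ℂ))).cexp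
  refine h.congr_deriv ?_
  simp only [cosPhase]
  push_cast
  ring

lemma continuous_cosPhase (s : ℝ) : Continuous (cosPhase s) := by
  unfold cosPhase
  fun_prop

lemma sin_sq_add_sq_pos {d : ℝ} (hd : 0 < d) (l : ℝ) : 0 < Real.sin l ^ 2 + d ^ 2 := by
  positivity

lemma continuous_inv_sin_sq_add_sq {d : ℝ} (hd : 0 < d) :
    Continuous fun l : ℝ => (Real.sin l ^ 2 + d ^ 2)⁻¹ :=
  Continuous.inv₀ (by fun_prop) fun l => (sin_sq_add_sq_pos hd l).ne'

lemma integral_inv_sin_sq_add_sq_le {d : ℝ} (hd : 0 < d) :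
    ∫ l in (0 : ℝ)..Real.pi, (Real.sin l ^ 2 + d ^ 2)⁻¹ ≤ Real.pi ^ 2 / (2 * d) := by
  have hpi := Real.pi_pos
  set c : ℝ := 2 / Real.pi with hc
  have hc0 : 0 < c := by positivity
  have hF : ∀ x : ℝ, HasDerivAt (fun x => (c * d)⁻¹ * Real.arctan (c / d * x))
      ((c * x) ^ 2 + d ^ 2)⁻¹ x := by
    intro x
    have h := (((hasDerivAt_id x).const_mul (c / d)).arctan).const_mul (c * d)⁻¹
    refine h.congr_deriv ?_
    have h1 : (c * x) ^ 2 + d ^ 2 ≠ 0 := by positivity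
    have h2 : 1 + (c / d * x) ^ 2 ≠ 0 := by positivity
    simp only [id]
    field_simp
    ring
  have hcont : Continuous fun x : ℝ => ((c * x) ^ 2 + d ^ 2)⁻¹ :=
    Continuous.inv₀ (by fun_prop) fun x => by positivity
  have hcont' : Continuous fun x : ℝ => ((c * (Real.pi - x)) ^ 2 + d ^ 2)⁻¹ :=
    hcont.comp (by fun_prop : Continuous fun x : ℝ => Real.pi - x)
  have hint : ∫ x in (0 : ℝ)..Real.pi, ((c * x) ^ 2 + d ^ 2)⁻¹ ≤ Real.pi ^ 2 / (4 * d) := by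
    rw [intervalIntegral.integral_eq_sub_of_hasDerivAt (fun x _ => hF x)
      (hcont.intervalIntegrable _ _)]
    have h := (Real.arctan_lt_pi_div_two (c / d * Real.pi)).le
    calc _ = (c * d)⁻¹ * Real.arctan (c / d * Real.pi) := by simp
      _ ≤ (c * d)⁻¹ * (Real.pi / 2) := by gcongr
      _ = _ := by rw [hc]; field_simp; ring
  have hrefl : ∫ x in (0 : ℝ)..Real.pi, ((c * (Real.pi - x)) ^ 2 + d ^ 2)⁻¹ =
      ∫ x in (0 : ℝ)..Real.pi, ((c * x) ^ 2 + d ^ 2)⁻¹ := by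
    rw [intervalIntegral.integral_comp_sub_left (fun x => ((c * x) ^ 2 + d ^ 2)⁻¹)]
    simp
  have hle : ∀ x ∈ Set.Icc (0 : ℝ) Real.pi, (Real.sin x ^ 2 + d ^ 2)⁻¹ ≤
      ((c * x) ^ 2 + d ^ 2)⁻¹ + ((c * (Real.pi - x)) ^ 2 + d ^ 2)⁻¹ := by
    intro x hx
    have hA : 0 ≤ ((c * x) ^ 2 + d ^ 2)⁻¹ := by positivity
    have hB : 0 ≤ ((c * (Real.pi - x)) ^ 2 + d ^ 2)⁻¹ := by positivity
    rcases le_total x (Real.pi / 2) with h | h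
    · have hs : c * x ≤ Real.sin x := Real.mul_le_sin hx.1 h
      have : (Real.sin x ^ 2 + d ^ 2)⁻¹ ≤ ((c * x) ^ 2 + d ^ 2)⁻¹ := by
        have := mul_nonneg hc0.le hx.1
        gcongr
      linarith
    · have hx' : 0 ≤ Real.pi - x := by linarith [hx.2]
      have hs : c * (Real.pi - x) ≤ Real.sin x := by
        rw [← Real.sin_pi_sub x]
        exact Real.mul_le_sin hx' (by linarith)
      have : (Real.sin x ^ 2 + d ^ 2)⁻¹ ≤ ((c * (Real.pi - x)) ^ 2 + d ^ 2)⁻¹ := by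
        have := mul_nonneg hc0.le hx'
        gcongr
      linarith
  calc _ ≤ ∫ x in (0 : ℝ)..Real.pi,
        (((c * x) ^ 2 + d ^ 2)⁻¹ + ((c * (Real.pi - x)) ^ 2 + d ^ 2)⁻¹) :=
        intervalIntegral.integral_mono_on hpi.le
          ((continuous_inv_sin_sq_add_sq hd).intervalIntegrable _ _)
          ((hcont.add hcont').intervalIntegrable _ _) hle
    _ ≤ Real.pi ^ 2 / (4 * d) + Real.pi ^ 2 / (4 * d) := by
        rw [intervalIntegral.integral_add (hcont.intervalIntegrable _ _)
          (hcont'.intervalIntegrable _ _), hrefl]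
        exact add_le_add hint hint
    _ = _ := by field_simp; ring

/-- The derivative of `cos (m l) sin l / (sin² l + d²)`. -/
def regularizedDeriv (m d l : ℝ) : ℝ :=
  -(m * Real.sin (m * l)) * (Real.sin l * (Real.sin l ^ 2 + d ^ 2)⁻¹) +
    Real.cos (m * l) * (Real.cos l * (d ^ 2 - Real.sin l ^ 2) * ((Real.sin l ^ 2 + d ^ 2)⁻¹) ^ 2)

lemma continuous_regularizedDeriv {d : ℝ} (hd : 0 < d) (m : ℝ) :
    Continuous (regularizedDeriv m d) := by
  have := continuous_inv_sin_sq_add_sq hd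
  unfold regularizedDeriv
  fun_prop

lemma hasDerivAt_regularized {d : ℝ} (hd : 0 < d) (m l : ℝ) :
    HasDerivAt (fun l => Real.cos (m * l) * (Real.sin l * (Real.sin l ^ 2 + d ^ 2)⁻¹))
      (regularizedDeriv m d l) l := by
  have hD := (sin_sq_add_sq_pos hd l).ne'
  have h1 := ((hasDerivAt_id l).const_mul m).cos
  have h2 := (((Real.hasDerivAt_sin l).pow 2).add_const (d ^ 2)).inv hD
  refine (h1.mul ((Real.hasDerivAt_sin l).mul h2)).congr_deriv ?_
  simp only [regularizedDeriv, id, Pi.pow_apply, Pi.mul_apply, Pi.inv_apply]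
  field_simp
  ring

lemma abs_regularizedDeriv_le {m d : ℝ} (hm : 0 ≤ m) (hd : 0 < d) (l : ℝ) :
    |regularizedDeriv m d l| ≤ m / (2 * d) + (Real.sin l ^ 2 + d ^ 2)⁻¹ := by
  have hD := sin_sq_add_sq_pos hd l
  set D := Real.sin l ^ 2 + d ^ 2 with hDdef
  have h1 : |Real.sin l * D⁻¹| ≤ 1 / (2 * d) := by
    rw [abs_mul, abs_of_pos (inv_pos.2 hD), ← div_eq_mul_inv, div_le_div_iff₀ hD (by positivity)]
    nlinarith [sq_nonneg (|Real.sin l| - d), sq_abs (Real.sin l)]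
  have h2 : |Real.cos l * (d ^ 2 - Real.sin l ^ 2) * (D⁻¹) ^ 2| ≤ D⁻¹ := by
    have h3 : |d ^ 2 - Real.sin l ^ 2| ≤ D := by
      rw [abs_le]; constructor <;> nlinarith [sq_nonneg (Real.sin l), sq_nonneg d]
    rw [abs_mul, abs_mul, abs_of_pos (by positivity : 0 < (D⁻¹) ^ 2)]
    calc _ ≤ 1 * D * (D⁻¹) ^ 2 := by
          gcongr
          exact Real.abs_cos_le_one l
      _ = D⁻¹ := by field_simp
  calc _ ≤ |-(m * Real.sin (m * l))| * |Real.sin l * D⁻¹| +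
        |Real.cos (m * l)| * |Real.cos l * (d ^ 2 - Real.sin l ^ 2) * (D⁻¹) ^ 2| := by
        rw [← abs_mul, ← abs_mul]; exact abs_add_le _ _
    _ ≤ m * (1 / (2 * d)) + 1 * D⁻¹ := by
        gcongr
        · rw [abs_neg, abs_mul, abs_of_nonneg hm]
          exact mul_le_of_le_one_right hm (Real.abs_sin_le_one _)
        · exact Real.abs_cos_le_one _
    _ = _ := by ring

/-- Decay of the Bessel-type integral `∫₀^π e^{-is cos l} cos (m l) dl`, proved by integration by
parts away from the stationary points, the cutoff being `sin² / (sin² + d²)` with `d² = 1/|s|`. -/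
lemma norm_integral_cosPhase_mul_cos_le {m s d : ℝ} (hm : 0 ≤ m) (hd : 0 < d)
    (hsd : |s| * d ^ 2 = 1) :
    |s| * ‖∫ l in (0 : ℝ)..Real.pi, cosPhase s l * (Real.cos (m * l) : ℂ)‖ ≤
      (Real.pi ^ 2 + m * Real.pi / 2) / d := by
  have hpi := Real.pi_pos
  have hE := continuous_cosPhase s
  have hI := continuous_inv_sin_sq_add_sq hd
  have hR := continuous_regularizedDeriv hd m
  set r : ℝ → ℂ := fun l => Complex.I * s * cosPhase s l * (Real.cos (m * l) : ℂ) *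
    ((d ^ 2 * (Real.sin l ^ 2 + d ^ 2)⁻¹ : ℝ) : ℂ) - cosPhase s l * (regularizedDeriv m d l : ℂ)
    with hr
  have hrc : Continuous r := by
    fun_prop
  have hder : ∀ l : ℝ, HasDerivAt (fun l => cosPhase s l *
      ((Real.cos (m * l) * (Real.sin l * (Real.sin l ^ 2 + d ^ 2)⁻¹) : ℝ) : ℂ))
      (Complex.I * s * (cosPhase s l * (Real.cos (m * l) : ℂ)) - r l) l := by
    intro l
    refine ((hasDerivAt_cosPhase s l).mul (hasDerivAt_regularized hd m l).ofReal_comp).congr_deriv ?_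
    have hD : ((Real.sin l ^ 2 + d ^ 2 : ℝ) : ℂ) ≠ 0 :=
      Complex.ofReal_ne_zero.2 (sin_sq_add_sq_pos hd l).ne'
    simp only [hr]
    push_cast at hD ⊢
    field_simp
    ring
  have hcont : Continuous fun l : ℝ => Complex.I * s * (cosPhase s l * (Real.cos (m * l) : ℂ)) := by
    fun_prop
  have hzero := intervalIntegral.integral_eq_sub_of_hasDerivAt (a := 0) (b := Real.pi)
    (fun l _ => hder l) ((hcont.sub hrc).intervalIntegrable _ _)
  rw [intervalIntegral.integral_sub (hcont.intervalIntegrable _ _) (hrc.intervalIntegrable _ _),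
    intervalIntegral.integral_const_mul] at hzero
  simp only [Real.sin_pi, Real.sin_zero, zero_mul, mul_zero, Complex.ofReal_zero, sub_zero] at hzero
  rw [sub_eq_zero] at hzero
  have hnorm : |s| * ‖∫ l in (0 : ℝ)..Real.pi, cosPhase s l * (Real.cos (m * l) : ℂ)‖ =
      ‖∫ l in (0 : ℝ)..Real.pi, r l‖ := by
    rw [← hzero]; simp
  rw [hnorm]
  have hbd : ∀ l : ℝ, ‖r l‖ ≤ 2 * (Real.sin l ^ 2 + d ^ 2)⁻¹ + m / (2 * d) := by
    intro l
    have hD := inv_pos.2 (sin_sq_add_sq_pos hd l)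
    calc ‖r l‖ ≤ |s| * |Real.cos (m * l)| * (d ^ 2 * (Real.sin l ^ 2 + d ^ 2)⁻¹) +
          |regularizedDeriv m d l| := by
          refine (norm_sub_le _ _).trans (le_of_eq ?_)
          simp only [norm_mul, norm_cosPhase, Complex.norm_I, Complex.norm_real, Real.norm_eq_abs]
          rw [abs_of_pos hD, abs_of_pos (by positivity : 0 < d ^ 2)]
          ring
      _ ≤ |s| * 1 * (d ^ 2 * (Real.sin l ^ 2 + d ^ 2)⁻¹) +
          (m / (2 * d) + (Real.sin l ^ 2 + d ^ 2)⁻¹) := by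
          gcongr
          · exact Real.abs_cos_le_one _
          · exact abs_regularizedDeriv_le hm hd l
      _ = (|s| * d ^ 2) * (Real.sin l ^ 2 + d ^ 2)⁻¹ +
          (m / (2 * d) + (Real.sin l ^ 2 + d ^ 2)⁻¹) := by ring
      _ = _ := by rw [hsd]; ring
  calc ‖∫ l in (0 : ℝ)..Real.pi, r l‖
      ≤ ∫ l in (0 : ℝ)..Real.pi, (2 * (Real.sin l ^ 2 + d ^ 2)⁻¹ + m / (2 * d)) :=
        intervalIntegral.norm_integral_le_of_norm_le hpi.le
          (Filter.Eventually.of_forall fun l _ => hbd l)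
          (((hI.const_mul 2).add continuous_const).intervalIntegrable _ _)
    _ = 2 * (∫ l in (0 : ℝ)..Real.pi, (Real.sin l ^ 2 + d ^ 2)⁻¹) + Real.pi * (m / (2 * d)) := by
        rw [intervalIntegral.integral_add ((hI.const_mul 2).intervalIntegrable _ _)
          (continuous_const.intervalIntegrable _ _), intervalIntegral.integral_const_mul]
        rw [intervalIntegral.integral_const, sub_zero, smul_eq_mul]
    _ ≤ 2 * (Real.pi ^ 2 / (2 * d)) + Real.pi * (m / (2 * d)) := by
        gcongr
        exact integral_inv_sin_sq_add_sq_le hd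
    _ = _ := by field_simp

lemma norm_integral_cosPhase_sin_sin_le_pi (s m : ℝ) :
    ‖∫ l in (0 : ℝ)..Real.pi, cosPhase s l * (Real.sin l : ℂ) * (Real.sin (m * l) : ℂ)‖ ≤
      Real.pi := by
  have h := intervalIntegral.norm_integral_le_of_norm_le_const (a := 0) (b := Real.pi) (C := 1)
    (f := fun l : ℝ => cosPhase s l * (Real.sin l : ℂ) * (Real.sin (m * l) : ℂ)) (fun l _ => by
      rw [norm_mul, norm_mul, norm_cosPhase, one_mul, Complex.norm_real, Complex.norm_real]
      exact mul_le_one₀ (Real.abs_sin_le_one _) (norm_nonneg _) (Real.abs_sin_le_one _))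
  simpa [abs_of_pos Real.pi_pos] using h

lemma integral_cosPhase_sin_sin (s : ℝ) (m : ℕ) :
    Complex.I * s * ∫ l in (0 : ℝ)..Real.pi,
        cosPhase s l * (Real.sin l : ℂ) * (Real.sin (m * l) : ℂ) =
      -(m * ∫ l in (0 : ℝ)..Real.pi, cosPhase s l * (Real.cos (m * l) : ℂ)) := by
  have hE := continuous_cosPhase s
  have hder : ∀ l : ℝ, HasDerivAt (fun l => cosPhase s l * ((Real.sin (m * l) : ℝ) : ℂ))
      (Complex.I * s * (cosPhase s l * (Real.sin l : ℂ) * (Real.sin (m * l) : ℂ)) +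
        m * (cosPhase s l * (Real.cos (m * l) : ℂ))) l := by
    intro l
    have h := (((hasDerivAt_id l).const_mul (m : ℝ)).sin).ofReal_comp
    refine ((hasDerivAt_cosPhase s l).mul h).congr_deriv ?_
    simp only [id]
    push_cast
    ring
  have hc1 : Continuous fun l : ℝ => Complex.I * s *
      (cosPhase s l * (Real.sin l : ℂ) * (Real.sin (m * l) : ℂ)) := by fun_prop
  have hc2 : Continuous fun l : ℝ => (m : ℂ) * (cosPhase s l * (Real.cos (m * l) : ℂ)) := by
    fun_prop
  have h := intervalIntegral.integral_eq_sub_of_hasDerivAt (a := 0) (b := Real.pi)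
    (fun l _ => hder l) ((hc1.add hc2).intervalIntegrable _ _)
  rw [intervalIntegral.integral_add (hc1.intervalIntegrable _ _) (hc2.intervalIntegrable _ _),
    intervalIntegral.integral_const_mul, intervalIntegral.integral_const_mul] at h
  simp only [Real.sin_nat_mul_pi, Real.sin_zero, mul_zero, Complex.ofReal_zero, sub_zero] at h
  exact eq_neg_of_add_eq_zero_left h

lemma norm_integral_cosPhase_sin_sin_le {s : ℝ} (hs : s ≠ 0) {m : ℕ} (hm : 1 ≤ m) :
    ‖∫ l in (0 : ℝ)..Real.pi, cosPhase s l * (Real.sin l : ℂ) * (Real.sin (m * l) : ℂ)‖ ≤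
      16 * (m : ℝ) ^ 2 * |s| ^ (-(3 / 2) : ℝ) := by
  have hs' : 0 < |s| := abs_pos.2 hs
  have hm' : (1 : ℝ) ≤ m := by exact_mod_cast hm
  set d : ℝ := |s| ^ (-(1 / 2) : ℝ) with hd
  have hd0 : 0 < d := Real.rpow_pos_of_pos hs' _
  have hd2 : d ^ 2 = |s|⁻¹ := by
    rw [hd, ← Real.rpow_natCast, ← Real.rpow_mul hs'.le, ← Real.rpow_neg_one]
    norm_num
  have hd3 : |s| ^ (-(3 / 2) : ℝ) = d ^ 3 := by
    rw [hd, ← Real.rpow_natCast, ← Real.rpow_mul hs'.le]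
    norm_num
  have hsd : |s| * d ^ 2 = 1 := by rw [hd2]; exact mul_inv_cancel₀ hs'.ne'
  have h1 := norm_integral_cosPhase_mul_cos_le (m := m) (by positivity) hd0 hsd
  have h2 := congrArg norm (integral_cosPhase_sin_sin s m)
  rw [norm_mul, norm_mul, Complex.norm_I, Complex.norm_real, Real.norm_eq_abs, one_mul, norm_neg,
    norm_mul, Complex.norm_natCast] at h2
  set A := ‖∫ l in (0 : ℝ)..Real.pi, cosPhase s l * (Real.sin l : ℂ) * (Real.sin (m * l) : ℂ)‖
  set B := ‖∫ l in (0 : ℝ)..Real.pi, cosPhase s l * (Real.cos (m * l) : ℂ)‖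
  have hpi : Real.pi ^ 2 + m * Real.pi / 2 ≤ 16 * m := by
    nlinarith [Real.pi_pos, Real.pi_lt_d2]
  rw [hd3]
  calc A = |s| * A * d ^ 2 := by rw [mul_right_comm, hsd, one_mul]
    _ = m * (|s| * B) * (d ^ 2 * d ^ 2) := by
        rw [h2]
        linear_combination (-(m * B * d ^ 2)) * hsd
    _ ≤ m * ((16 * m) / d) * (d ^ 2 * d ^ 2) := by
        gcongr
        exact h1.trans (by gcongr)
    _ = _ := by field_simp

lemma summable_two_mul_add_one_sq_mul_rpow_neg {q : ℝ} (hq : 1 < q) :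
    Summable fun k : ℕ => (2 * (k : ℝ) + 1) ^ 2 * q ^ (-(k : ℝ)) := by
  have hq0 : 0 < q := by linarith
  have hr : ‖q⁻¹‖ < 1 := by
    rw [Real.norm_eq_abs, abs_of_pos (inv_pos.2 hq0)]
    exact inv_lt_one_of_one_lt₀ hq
  have h0 := summable_pow_mul_geometric_of_norm_lt_one 0 hr
  have h1 := summable_pow_mul_geometric_of_norm_lt_one 1 hr
  have h2 := summable_pow_mul_geometric_of_norm_lt_one 2 hr
  refine (((h2.mul_left 4).add (h1.mul_left 4)).add h0).congr fun k => ?_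
  rw [Real.rpow_neg hq0.le, Real.rpow_natCast, inv_pow]
  ring

/-- A bound on the oscillatory integrals that is quadratic in the frequency transfers to the
kernel. -/
lemma norm_schKernel_le {Q : ℕ} (hQ : 2 ≤ Q) {t M : ℝ} {n : ℕ}
    (hM : ∀ k : ℕ, ‖∫ l in (0 : ℝ)..Real.pi, cosPhase (gammaZero Q * t) l * (Real.sin l : ℂ) *
      (Real.sin (((n + 2 * k + 1 : ℕ) : ℝ) * l) : ℂ)‖ ≤ M * (2 * (k : ℝ) + 1) ^ 2) :
    ‖schKernel Q t n‖ ≤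
      M * (∑' k : ℕ, (2 * (k : ℝ) + 1) ^ 2 * (Q : ℝ) ^ (-(k : ℝ))) * (Q : ℝ) ^ (-(n : ℝ) / 2) := by
  have hQ1 : (1 : ℝ) < Q := by exact_mod_cast hQ
  have hQ0 : (0 : ℝ) < Q := by linarith
  have hpi := Real.pi_gt_three
  have hsum := ((summable_two_mul_add_one_sq_mul_rpow_neg hQ1).hasSum.mul_left M).mul_right
    ((Q : ℝ) ^ (-(n : ℝ) / 2))
  have hterm := tsum_of_norm_bounded (f := fun k : ℕ =>
      (((Q : ℝ) ^ (-(n : ℝ) / 2 - (k : ℝ)) : ℝ) : ℂ) *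
      ∫ l in (0 : ℝ)..Real.pi,
        Complex.exp (-Complex.I * (gammaZero Q) * t * Real.cos l) *
          (Real.sin l : ℂ) * (Real.sin (((n : ℝ) + 2 * k + 1) * l) : ℂ)) hsum (fun k => by
    have h := hM k
    simp only [cosPhase, Nat.cast_add, Nat.cast_mul, Nat.cast_ofNat, Nat.cast_one,
      Complex.ofReal_mul (gammaZero Q) t, ← mul_assoc (-Complex.I)] at h
    have hp : 0 < (Q : ℝ) ^ (-(n : ℝ) / 2 - (k : ℝ)) := Real.rpow_pos_of_pos hQ0 _
    rw [norm_mul, Complex.norm_real, Real.norm_eq_abs, abs_of_pos hp]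
    refine (mul_le_mul_of_nonneg_left h hp.le).trans (le_of_eq ?_)
    rw [sub_eq_add_neg, Real.rpow_add hQ0]
    ring)
  have hpre : ‖Complex.exp (Complex.I * t) * (2 / Real.pi)‖ ≤ 1 := by
    rw [norm_mul, mul_comm Complex.I, Complex.norm_exp_ofReal_mul_I, one_mul, norm_div,
      Complex.norm_real, Real.norm_eq_abs, abs_of_pos Real.pi_pos, Complex.norm_ofNat,
      div_le_one Real.pi_pos]
    linarith
  rw [schKernel, norm_mul]
  exact (mul_le_of_le_one_left (norm_nonneg _) hpre).trans hterm

/-- Pointwise estimates for the Schrödinger kernel: there exists `C > 0`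
(depending only on `Q`) such that `|s_t(n)| ≤ C Q^{-n/2}` for `|t| < 1` and
`|s_t(n)| ≤ C |t|^{-3/2} (1+n)² Q^{-n/2}` for `|t| ≥ 1`. -/
theorem kernel_pointwise_estimates (Q : ℕ) (hQ : 2 ≤ Q) :
    ∃ C : ℝ, 0 < C ∧ ∀ (t : ℝ) (n : ℕ),
      (|t| < 1 → ‖schKernel Q t n‖ ≤ C * (Q : ℝ) ^ (-(n : ℝ) / 2)) ∧
      (1 ≤ |t| → ‖schKernel Q t n‖ ≤
        C * |t| ^ (-(3 / 2) : ℝ) * (1 + (n : ℝ)) ^ 2 * (Q : ℝ) ^ (-(n : ℝ) / 2)) := by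
  have hQ1 : (1 : ℝ) < Q := by exact_mod_cast hQ
  have hQ0 : (0 : ℝ) < Q := by linarith
  have hpi := Real.pi_pos
  have hγ : 0 < gammaZero Q := by
    unfold gammaZero
    positivity
  set S : ℝ := ∑' k : ℕ, (2 * (k : ℝ) + 1) ^ 2 * (Q : ℝ) ^ (-(k : ℝ))
  have hS : 0 < S := (summable_two_mul_add_one_sq_mul_rpow_neg hQ1).tsum_pos
    (fun k => by positivity) 0 (by positivity)
  set G : ℝ := gammaZero Q ^ (-(3 / 2) : ℝ)
  have hG : 0 < G := Real.rpow_pos_of_pos hγ _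
  refine ⟨(Real.pi + 16 * G) * S, by positivity, fun t n => ⟨fun _ => ?_, fun ht => ?_⟩⟩
  · refine norm_schKernel_le hQ fun k => (norm_integral_cosPhase_sin_sin_le_pi _ _).trans ?_
    have hk : (1 : ℝ) ≤ (2 * (k : ℝ) + 1) ^ 2 := one_le_pow₀ (by linarith [k.cast_nonneg (α := ℝ)])
    nlinarith
  · have ht0 : t ≠ 0 := abs_pos.1 (by linarith)
    have hT : 0 < |t| ^ (-(3 / 2) : ℝ) := Real.rpow_pos_of_pos (abs_pos.2 ht0) _
    have hs : |gammaZero Q * t| ^ (-(3 / 2) : ℝ) = G * |t| ^ (-(3 / 2) : ℝ) := by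
      rw [abs_mul, abs_of_pos hγ, Real.mul_rpow hγ.le (abs_nonneg t)]
    have h := norm_schKernel_le (t := t) (n := n) hQ
      (M := (Real.pi + 16 * G) * |t| ^ (-(3 / 2) : ℝ) * (1 + (n : ℝ)) ^ 2) fun k => by
        refine (norm_integral_cosPhase_sin_sin_le (mul_ne_zero hγ.ne' ht0) (by omega)).trans ?_
        rw [hs]
        have hk : ((n + 2 * k + 1 : ℕ) : ℝ) ≤ (1 + n) * (2 * k + 1) := by
          exact_mod_cast (by nlinarith [Nat.zero_le (n * k)] : n + 2 * k + 1 ≤ (1 + n) * (2 * k + 1))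
        calc _ ≤ 16 * ((1 + n) * (2 * k + 1) : ℝ) ^ 2 * (G * |t| ^ (-(3 / 2) : ℝ)) := by gcongr
          _ = (16 * G) * |t| ^ (-(3 / 2) : ℝ) * (1 + (n : ℝ)) ^ 2 * (2 * (k : ℝ) + 1) ^ 2 := by
            ring
          _ ≤ _ := by
            gcongr
            linarith
    refine h.trans (le_of_eq ?_)
    ring
end
end
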